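/- arXiv:1401.0542 — 4 statements merged into one kernel-verified Lean document; each statement's English description precedes it below -/
import Mathlib

section
/- (Marr conjecture in one dimension, part (b): failure when the scales tend only to zero) There exist a compactly supported integrable function h : ℝ → ℝ with h not almost everywhere zero (so that G + h is not a constant multiple of G), and a strictly decreasing sequence (σ_k)_{k≥1} of positive reals with σ_k → 0, such that for every k the zero set {x ∈ ℝ : ((G+h)*M_{σ_k})(x) = 0} equals the zero set {x ∈ ℝ : (G*M_{σ_k})(x) = 0}. -/
open MeasureTheory Real Filter Topology

noncomputable section

/-- The standard Gaussian `G(x) = (2π)^{-1/2} e^{-x²/2}`. -/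
def gauss (x : ℝ) : ℝ := (Real.sqrt (2 * Real.pi))⁻¹ * Real.exp (-x ^ 2 / 2)

/-- The Ricker (Mexican hat) wavelet `M = G''`, i.e. `M(x) = (x² - 1) G(x)`. -/
def ricker (x : ℝ) : ℝ := (x ^ 2 - 1) * gauss x

/-- The transform `(f * φ_σ)(x)` with `φ_σ(x) = σ⁻¹ φ(x/σ)`. -/
def convScaled1 (f φ : ℝ → ℝ) (σ : ℝ) (x : ℝ) : ℝ :=
  ∫ y, f y * (σ⁻¹ * φ ((x - y) / σ))


lemma gauss_eq_gaussianPDFReal : gauss = ProbabilityTheory.gaussianPDFReal 0 1 := by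
  ext x
  simp [gauss, ProbabilityTheory.gaussianPDFReal]

lemma gauss_pos (x : ℝ) : 0 < gauss x := by
  unfold gauss
  positivity

lemma continuous_gauss : Continuous gauss := by
  unfold gauss
  fun_prop

lemma continuous_ricker : Continuous ricker := by
  have := continuous_gauss
  unfold ricker
  fun_prop

lemma gauss_neg (x : ℝ) : gauss (-x) = gauss x := by
  simp [gauss]

lemma ricker_neg (x : ℝ) : ricker (-x) = ricker x := by
  simp [ricker, gauss_neg]

lemma integrable_gauss : Integrable gauss := by
  rw [gauss_eq_gaussianPDFReal]
  exact ProbabilityTheory.integrable_gaussianPDFReal 0 1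

lemma integral_gauss : ∫ z, gauss z = 1 := by
  rw [gauss_eq_gaussianPDFReal]
  exact ProbabilityTheory.integral_gaussianPDFReal_eq_one 0 one_ne_zero

lemma integrable_mul_gauss : Integrable fun z => z * gauss z := by
  have h := (integrable_mul_exp_neg_mul_sq (b := 1 / 2) (by norm_num)).const_mul
    (Real.sqrt (2 * Real.pi))⁻¹
  refine h.congr (Eventually.of_forall fun z => ?_)
  simp only [gauss]
  ring_nf

lemma integrable_sq_mul_gauss : Integrable fun z => z ^ 2 * gauss z := by
  have h := (integrable_rpow_mul_exp_neg_mul_sq (b := 1 / 2) (by norm_num) (s := 2)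
    (by norm_num)).const_mul (Real.sqrt (2 * Real.pi))⁻¹
  refine h.congr (Eventually.of_forall fun z => ?_)
  simp only [gauss, Real.rpow_two]
  ring_nf

lemma exists_norm_ricker_le : ∃ C, ∀ x, ‖ricker x‖ ≤ C := by
  refine ⟨2 * (Real.sqrt (2 * Real.pi))⁻¹, fun x => ?_⟩
  have h1 : |x ^ 2 - 1| ≤ 2 * Real.exp (x ^ 2 / 2) := by
    have := Real.add_one_le_exp (x ^ 2 / 2)
    rw [abs_le]
    constructor <;> nlinarith [sq_nonneg x, Real.exp_pos (x ^ 2 / 2)]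
  rw [ricker, norm_mul, Real.norm_eq_abs, Real.norm_eq_abs, abs_of_pos (gauss_pos x)]
  calc |x ^ 2 - 1| * gauss x ≤ 2 * Real.exp (x ^ 2 / 2) * gauss x :=
        mul_le_mul_of_nonneg_right h1 (gauss_pos x).le
    _ = 2 * (Real.sqrt (2 * Real.pi))⁻¹ * (Real.exp (x ^ 2 / 2) * Real.exp (-x ^ 2 / 2)) := by
        rw [gauss]; ring
    _ = 2 * (Real.sqrt (2 * Real.pi))⁻¹ := by rw [← Real.exp_add]; simp [neg_div]

lemma integrable_ricker : Integrable ricker := by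
  refine (integrable_sq_mul_gauss.sub integrable_gauss).congr (Eventually.of_forall fun z => ?_)
  simp only [ricker, Pi.sub_apply]
  ring

lemma integral_gaussianReal_eq_integral_mul_gauss (f : ℝ → ℝ) :
    ∫ z, f z ∂(ProbabilityTheory.gaussianReal 0 1) = ∫ z, f z * gauss z := by
  rw [ProbabilityTheory.integral_gaussianReal_eq_integral_smul one_ne_zero,
    gauss_eq_gaussianPDFReal]
  simp [mul_comm]

lemma integral_mul_gauss : ∫ z, z * gauss z = 0 := by
  rw [← integral_gaussianReal_eq_integral_mul_gauss fun z => z,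
    ProbabilityTheory.integral_id_gaussianReal]

lemma integral_sq_mul_gauss : ∫ z, z ^ 2 * gauss z = 1 := by
  have h := ProbabilityTheory.variance_fun_id_gaussianReal (μ := 0) (v := 1)
  rw [ProbabilityTheory.variance_eq_integral (by fun_prop),
    ProbabilityTheory.integral_id_gaussianReal] at h
  simpa [← integral_gaussianReal_eq_integral_mul_gauss fun z => z ^ 2] using h

lemma gauss_hasDerivAt (x : ℝ) : HasDerivAt gauss (-x * gauss x) x := by
  have h : HasDerivAt (fun x : ℝ => -x ^ 2 / 2) (-x) x := by
    have h2 : HasDerivAt (fun x : ℝ => -x ^ 2 / 2) _ x := (hasDerivAt_pow 2 x).neg.div_const 2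
    exact h2.congr_deriv (by norm_num; ring)
  have h2 : HasDerivAt gauss _ x := h.exp.const_mul (Real.sqrt (2 * Real.pi))⁻¹
  exact h2.congr_deriv (by simp only [gauss]; ring)

/-- The heat-flow value `(G * G_σ)(x)`, i.e. the density at `x` of a centred Gaussian of
variance `1 + σ²`. -/
def heatGauss (σ x : ℝ) : ℝ :=
  (Real.sqrt (2 * Real.pi))⁻¹ * (Real.sqrt (1 + σ ^ 2))⁻¹ *
    Real.exp (-x ^ 2 / (2 * (1 + σ ^ 2)))

lemma heatGauss_pos (σ x : ℝ) : 0 < heatGauss σ x := by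
  unfold heatGauss
  positivity

/-- Completing the square in a product of two Gaussians. -/
lemma gauss_mul_gauss {σ : ℝ} (hσ : 0 < σ) (x z : ℝ) :
    (σ / Real.sqrt (1 + σ ^ 2)) *
      (gauss (x / (1 + σ ^ 2) + σ / Real.sqrt (1 + σ ^ 2) * z) *
        (σ⁻¹ * gauss ((x - (x / (1 + σ ^ 2) + σ / Real.sqrt (1 + σ ^ 2) * z)) / σ))) =
      heatGauss σ x * gauss z := by
  have hS : 0 < 1 + σ ^ 2 := by positivity
  obtain ⟨s, hs, hs2⟩ : ∃ s : ℝ, 0 < s ∧ s ^ 2 = 1 + σ ^ 2 :=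
    ⟨_, Real.sqrt_pos.2 hS, Real.sq_sqrt hS.le⟩
  have hsq : Real.sqrt (1 + σ ^ 2) = s := by rw [← hs2, Real.sqrt_sq hs.le]
  simp only [gauss, heatGauss, hsq]
  rw [← hs2]
  set c := (Real.sqrt (2 * Real.pi))⁻¹
  have e : Real.exp (-(x / s ^ 2 + σ / s * z) ^ 2 / 2) *
      Real.exp (-((x - (x / s ^ 2 + σ / s * z)) / σ) ^ 2 / 2) =
      Real.exp (-x ^ 2 / (2 * s ^ 2)) * Real.exp (-z ^ 2 / 2) := by
    rw [← Real.exp_add, ← Real.exp_add]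
    congr 1
    field_simp
    have h : σ ^ 2 = s ^ 2 - 1 := by linarith
    have h4 : σ ^ 4 = (s ^ 2 - 1) ^ 2 := by rw [← h]; ring
    have h3 : σ ^ 3 = (s ^ 2 - 1) * σ := by rw [← h]; ring
    ring_nf
    simp only [h, h3, h4]
    ring
  calc _ = c * c * s⁻¹ * (Real.exp (-(x / s ^ 2 + σ / s * z) ^ 2 / 2) *
      Real.exp (-((x - (x / s ^ 2 + σ / s * z)) / σ) ^ 2 / 2)) := by
        field_simp
    _ = _ := by rw [e]; ring

lemma integral_mul_gauss_mul_gauss (F : ℝ → ℝ) {σ : ℝ} (hσ : 0 < σ) (x : ℝ) :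
    ∫ y, F y * (gauss y * (σ⁻¹ * gauss ((x - y) / σ))) =
      heatGauss σ x *
        ∫ z, F (x / (1 + σ ^ 2) + σ / Real.sqrt (1 + σ ^ 2) * z) * gauss z := by
  have hS : 0 < 1 + σ ^ 2 := by positivity
  set τ := σ / Real.sqrt (1 + σ ^ 2) with hτ
  have hτ0 : 0 < τ := div_pos hσ (Real.sqrt_pos.2 hS)
  set μ := x / (1 + σ ^ 2) with hμ
  set w : ℝ → ℝ := fun y => F y * (gauss y * (σ⁻¹ * gauss ((x - y) / σ))) with hw
  have h1 : ∫ y, w y = τ * ∫ z, w (μ + τ * z) := by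
    rw [Measure.integral_comp_mul_left (fun y => w (μ + y)) τ, integral_add_left_eq_self w μ,
      abs_of_pos (inv_pos.2 hτ0), smul_eq_mul, mul_inv_cancel_left₀ hτ0.ne']
  rw [h1, ← integral_const_mul, ← integral_const_mul]
  congr 1
  ext z
  have h2 := gauss_mul_gauss hσ x z
  rw [← hτ, ← hμ] at h2
  simp only [hw]
  linear_combination F (μ + τ * z) * h2

lemma convScaled1_gauss_ricker {σ : ℝ} (hσ : 0 < σ) (x : ℝ) :
    convScaled1 gauss ricker σ x =
      σ ^ 2 * heatGauss σ x * ((x / (1 + σ ^ 2)) ^ 2 - 1 / (1 + σ ^ 2)) := by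
  have hS : 0 < 1 + σ ^ 2 := by positivity
  have h := integral_mul_gauss_mul_gauss (fun y => ((x - y) / σ) ^ 2 - 1) hσ x
  have h0 : convScaled1 gauss ricker σ x =
      ∫ y, (((x - y) / σ) ^ 2 - 1) * (gauss y * (σ⁻¹ * gauss ((x - y) / σ))) := by
    unfold convScaled1 ricker
    congr 1
    ext y
    ring
  rw [h0, h]
  obtain ⟨s, hs, hs2⟩ : ∃ s : ℝ, 0 < s ∧ s ^ 2 = 1 + σ ^ 2 :=
    ⟨_, Real.sqrt_pos.2 hS, Real.sq_sqrt hS.le⟩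
  have hsq : Real.sqrt (1 + σ ^ 2) = s := by rw [← hs2, Real.sqrt_sq hs.le]
  rw [hsq, ← hs2]
  have h2 : ∀ z, (((x - (x / s ^ 2 + σ / s * z)) / σ) ^ 2 - 1) * gauss z =
      ((x * σ / s ^ 2) ^ 2 - 1) * gauss z - 2 * (x * σ / s ^ 2) / s * (z * gauss z) +
        (1 / s ^ 2) * (z ^ 2 * gauss z) := by
    intro z
    have h3 : (x - (x / s ^ 2 + σ / s * z)) / σ = x * σ / s ^ 2 - z / s := by
      field_simp
      linear_combination x * hs2
    rw [h3]
    ring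
  simp_rw [h2]
  have h3 : Integrable fun z => ((x * σ / s ^ 2) ^ 2 - 1) * gauss z -
      2 * (x * σ / s ^ 2) / s * (z * gauss z) :=
    (integrable_gauss.const_mul _).sub (integrable_mul_gauss.const_mul _)
  rw [integral_add h3 (integrable_sq_mul_gauss.const_mul _), integral_sub (integrable_gauss.const_mul _) (integrable_mul_gauss.const_mul _),
    integral_const_mul, integral_const_mul, integral_const_mul, integral_gauss,
    integral_mul_gauss, integral_sq_mul_gauss]
  field_simp
  have h : σ ^ 2 = s ^ 2 - 1 := by linarith
  rw [h]
  ring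

/-- A two-sided quadratic bound on the convexity defect of `φ`. -/
def ConvexityDefectLE (A : ℝ) (φ : ℝ → ℝ) : Prop :=
  ∀ a b α β : ℝ, 0 ≤ α → 0 ≤ β → α + β = 1 →
    |φ (α * a + β * b) - α * φ a - β * φ b| ≤ A * (α * β * (a - b) ^ 2)

lemma ContDiff.exists_convexityDefectLE {r : ℝ → ℝ} (hr : ContDiff ℝ 2 r)
    (hc : HasCompactSupport r) : ∃ A, 0 ≤ A ∧ ConvexityDefectLE A r := by
  have hd : Differentiable ℝ r := hr.differentiable (by norm_num)
  have hr1 : ContDiff ℝ 1 (deriv r) := hr.deriv' (n := 1)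
  have hdd : Differentiable ℝ (deriv r) := hr1.differentiable (by norm_num)
  have hcont : Continuous (deriv (deriv r)) := hr1.continuous_deriv (by norm_num)
  obtain ⟨C, hC⟩ := hc.deriv.deriv.exists_bound_of_continuous hcont
  have hC0 : 0 ≤ C := (norm_nonneg _).trans (hC 0)
  have key : ∀ e : ℝ, |e| = 1 → ConvexOn ℝ Set.univ fun y => C / 2 * y ^ 2 + e * r y := by
    intro e he
    have h1 : ∀ y, HasDerivAt (fun y => C / 2 * y ^ 2 + e * r y) (C * y + e * deriv r y) y := by
      intro y
      have h2 : HasDerivAt (fun y => C / 2 * y ^ 2 + e * r y) _ y :=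
        ((hasDerivAt_pow 2 y).const_mul (C / 2)).add ((hd y).hasDerivAt.const_mul e)
      exact h2.congr_deriv (by norm_num; ring)
    have h1' : deriv (fun y => C / 2 * y ^ 2 + e * r y) = fun y => C * y + e * deriv r y :=
      funext fun y => (h1 y).deriv
    have h2 : ∀ y, HasDerivAt (fun y => C * y + e * deriv r y) (C + e * deriv (deriv r) y) y := by
      intro y
      have h3 : HasDerivAt (fun y => C * y + e * deriv r y) _ y :=
        ((hasDerivAt_id y).const_mul C).add ((hdd y).hasDerivAt.const_mul e)
      exact h3.congr_deriv (by norm_num)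
    refine convexOn_univ_of_deriv2_nonneg (fun y => (h1 y).differentiableAt) ?_ ?_
    · rw [h1']
      exact fun y => (h2 y).differentiableAt
    · intro y
      rw [Function.iterate_succ, Function.iterate_one, Function.comp, h1', (h2 y).deriv]
      have h3 : |e * deriv (deriv r) y| ≤ C := by
        rw [abs_mul, he, one_mul]
        exact hC y
      linarith [(abs_le.1 h3).1]
  refine ⟨C / 2, by positivity, fun a b α β hα hβ hαβ => ?_⟩
  have h1 := (key 1 (by simp)).2 (Set.mem_univ a) (Set.mem_univ b) hα hβ hαβ
  have h2 := (key (-1) (by simp)).2 (Set.mem_univ a) (Set.mem_univ b) hα hβ hαβ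
  simp only [smul_eq_mul] at h1 h2
  have h3 : α * β * (a - b) ^ 2 = α * a ^ 2 + β * b ^ 2 - (α * a + β * b) ^ 2 := by
    have : β = 1 - α := by linarith
    subst this
    ring
  rw [h3, abs_le]
  constructor <;> nlinarith

lemma ConvexityDefectLE.integral_gauss {A : ℝ} {r : ℝ → ℝ} (h : ConvexityDefectLE A r)
    (hr : Continuous r) (hc : HasCompactSupport r) (τ : ℝ) :
    ConvexityDefectLE A fun μ => ∫ z, r (μ + τ * z) * gauss z := by
  obtain ⟨C, hC⟩ := hc.exists_bound_of_continuous hr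
  have hint : ∀ μ, Integrable fun z => r (μ + τ * z) * gauss z := fun μ =>
    integrable_gauss.bdd_mul (c := C) (by fun_prop) (Eventually.of_forall fun z => hC _)
  intro a b α β hα hβ hαβ
  have e : (∫ z, r (α * a + β * b + τ * z) * gauss z) - α * (∫ z, r (a + τ * z) * gauss z) -
      β * (∫ z, r (b + τ * z) * gauss z) =
      ∫ z, (r (α * a + β * b + τ * z) - α * r (a + τ * z) - β * r (b + τ * z)) * gauss z := by
    have h1 : Integrable fun z => r (α * a + β * b + τ * z) * gauss z -
        α * (r (a + τ * z) * gauss z) := (hint _).sub ((hint _).const_mul _)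
    rw [← integral_const_mul, ← integral_const_mul, ← integral_sub (hint _) ((hint _).const_mul _),
      ← integral_sub h1 ((hint _).const_mul _)]
    congr 1
    ext z
    ring
  simp only
  rw [e]
  have h2 : ∫ z, A * (α * β * (a - b) ^ 2) * gauss z = A * (α * β * (a - b) ^ 2) := by
    rw [integral_const_mul, _root_.integral_gauss, mul_one]
  rw [← h2, ← Real.norm_eq_abs]
  refine norm_integral_le_of_norm_le (integrable_gauss.const_mul _)
    (Eventually.of_forall fun z => ?_)
  rw [norm_mul, Real.norm_eq_abs, Real.norm_eq_abs, abs_of_pos (gauss_pos z)]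
  refine mul_le_mul_of_nonneg_right ?_ (gauss_pos z).le
  have h3 := h (a + τ * z) (b + τ * z) α β hα hβ hαβ
  have h4 : α * (a + τ * z) + β * (b + τ * z) = α * a + β * b + τ * z := by
    linear_combination (τ * z) * hαβ
  rw [h4] at h3
  simpa using h3

lemma convScaled1_ricker_eq {b : ℝ → ℝ} (hb : ContDiff ℝ 2 b) (hc : HasCompactSupport b)
    {σ : ℝ} (hσ : 0 < σ) (x : ℝ) :
    convScaled1 b ricker σ x =
      σ ^ 2 * ∫ y, deriv (deriv b) y * (σ⁻¹ * gauss ((x - y) / σ)) := by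
  have hd : Differentiable ℝ b := hb.differentiable (by norm_num)
  have hb1 : ContDiff ℝ 1 (deriv b) := hb.deriv' (n := 1)
  have hdd : Differentiable ℝ (deriv b) := hb1.differentiable (by norm_num)
  have hcont : Continuous (deriv (deriv b)) := hb1.continuous_deriv (by norm_num)
  set g : ℝ → ℝ := fun y => σ * gauss ((x - y) / σ) with hg
  set g' : ℝ → ℝ := fun y => (x - y) / σ * gauss ((x - y) / σ) with hg'
  set g'' : ℝ → ℝ := fun y => σ⁻¹ * ricker ((x - y) / σ) with hg''
  have hcg := continuous_gauss
  have hcr := continuous_ricker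
  have hlin : ∀ y, HasDerivAt (fun y : ℝ => (x - y) / σ) (-1 / σ) y := fun y =>
    ((hasDerivAt_id y).const_sub x).div_const σ
  have d0 : ∀ y, HasDerivAt (fun y => gauss ((x - y) / σ))
      (-((x - y) / σ) * gauss ((x - y) / σ) * (-1 / σ)) y := fun y =>
    (gauss_hasDerivAt _).comp y (hlin y)
  have d1 : ∀ y, HasDerivAt g (g' y) y := fun y =>
    ((d0 y).const_mul σ).congr_deriv (by simp only [hg']; field_simp)
  have d2 : ∀ y, HasDerivAt g' (g'' y) y := fun y =>
    ((hlin y).mul (d0 y)).congr_deriv (by simp only [hg'', ricker]; field_simp; ring)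
  have cg : Continuous g := by fun_prop
  have cg' : Continuous g' := by fun_prop
  have cg'' : Continuous g'' := by fun_prop
  have i1 := integral_mul_deriv_eq_deriv_mul_of_integrable (u := b) (v := g') (u' := deriv b)
    (v' := g'') (fun y _ => (hd y).hasDerivAt) (fun y _ => d2 y)
    ((hb.continuous.mul cg'').integrable_of_hasCompactSupport hc.mul_right)
    ((hb1.continuous.mul cg').integrable_of_hasCompactSupport hc.deriv.mul_right)
    ((hb.continuous.mul cg').integrable_of_hasCompactSupport hc.mul_right)
  have i2 := integral_mul_deriv_eq_deriv_mul_of_integrable (u := deriv b) (v := g)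
    (u' := deriv (deriv b)) (v' := g') (fun y _ => (hdd y).hasDerivAt) (fun y _ => d1 y)
    ((hb1.continuous.mul cg').integrable_of_hasCompactSupport hc.deriv.mul_right)
    ((hcont.mul cg).integrable_of_hasCompactSupport hc.deriv.deriv.mul_right)
    ((hb1.continuous.mul cg).integrable_of_hasCompactSupport hc.deriv.mul_right)
  have i3 : convScaled1 b ricker σ x = ∫ y, b y * g'' y := rfl
  rw [i3, i1, i2, neg_neg, ← integral_const_mul]
  congr 1
  ext y
  simp only [hg]
  field_simp

/-- The Ricker transform of `h` relative to the heat flow of the Gaussian, in the variable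
`μ = x / (1 + σ²)`. -/
def relRicker (h : ℝ → ℝ) (σ μ : ℝ) : ℝ :=
  convScaled1 h ricker σ ((1 + σ ^ 2) * μ) / (σ ^ 2 * heatGauss σ ((1 + σ ^ 2) * μ))

lemma ContDiff.exists_convexityDefectLE_relRicker {b : ℝ → ℝ} (hb : ContDiff ℝ 4 b)
    (hc : HasCompactSupport b) :
    ∃ A, 0 ≤ A ∧ ∀ σ, 0 < σ → ConvexityDefectLE A (relRicker b σ) := by
  set E : ℝ → ℝ := fun y => Real.sqrt (2 * Real.pi) * Real.exp (y ^ 2 / 2) with hE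
  set r : ℝ → ℝ := fun y => deriv (deriv b) y * E y with hr
  have hb3 : ContDiff ℝ 3 (deriv b) := hb.deriv' (n := 3)
  have hb2 : ContDiff ℝ 2 (deriv (deriv b)) := hb3.deriv' (n := 2)
  have hrd : ContDiff ℝ 2 r := by
    have : ContDiff ℝ 2 E := by fun_prop
    exact hb2.mul this
  have hrc : HasCompactSupport r := hc.deriv.deriv.mul_right
  obtain ⟨A, hA, hAr⟩ := hrd.exists_convexityDefectLE hrc
  refine ⟨A, hA, fun σ hσ => ?_⟩
  have hS : 0 < 1 + σ ^ 2 := by positivity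
  have hrel : relRicker b σ =
      fun μ => ∫ z, r (μ + σ / Real.sqrt (1 + σ ^ 2) * z) * gauss z := by
    ext μ
    rw [relRicker, convScaled1_ricker_eq (hb.of_le (by norm_num)) hc hσ]
    have h1 := integral_mul_gauss_mul_gauss r hσ ((1 + σ ^ 2) * μ)
    rw [mul_div_cancel_left₀ μ hS.ne'] at h1
    have h2 : ∀ y, r y * (gauss y * (σ⁻¹ * gauss (((1 + σ ^ 2) * μ - y) / σ))) =
        deriv (deriv b) y * (σ⁻¹ * gauss (((1 + σ ^ 2) * μ - y) / σ)) := by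
      intro y
      have h3 : E y * gauss y = 1 := by
        simp only [hE, gauss]
        rw [mul_mul_mul_comm, ← Real.exp_add, mul_inv_cancel₀ (by positivity)]
        simp [neg_div]
      simp only [hr]
      linear_combination
        (deriv (deriv b) y * (σ⁻¹ * gauss (((1 + σ ^ 2) * μ - y) / σ))) * h3
    simp_rw [h2] at h1
    rw [h1]
    have := heatGauss_pos σ ((1 + σ ^ 2) * μ)
    field_simp
  rw [hrel]
  exact hAr.integral_gauss hrd.continuous hrc _

/-- A small even perturbation whose Ricker transform vanishes at `√(1 + σ²)` does not move the
zeros of the Ricker transform of the Gaussian at scale `σ`. -/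
lemma zero_set_add_eq {h : ℝ → ℝ} (hint : Integrable h) (heven : ∀ x, h (-x) = h x) {σ : ℝ}
    (hσ : 0 < σ) {A : ℝ} (hA : A < 1) (hrel : ConvexityDefectLE A (relRicker h σ))
    (hzero : convScaled1 h ricker σ (Real.sqrt (1 + σ ^ 2)) = 0) :
    {x : ℝ | convScaled1 (fun y => gauss y + h y) ricker σ x = 0} =
      {x : ℝ | convScaled1 gauss ricker σ x = 0} := by
  have hS : 0 < 1 + σ ^ 2 := by positivity
  obtain ⟨s, hs, hs2⟩ : ∃ s : ℝ, 0 < s ∧ s ^ 2 = 1 + σ ^ 2 :=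
    ⟨_, Real.sqrt_pos.2 hS, Real.sq_sqrt hS.le⟩
  have hsq : Real.sqrt (1 + σ ^ 2) = s := by rw [← hs2, Real.sqrt_sq hs.le]
  rw [hsq] at hzero
  have hcr := continuous_ricker
  have hcg := continuous_gauss
  obtain ⟨C, hC⟩ := exists_norm_ricker_le
  have hmul : ∀ f : ℝ → ℝ, Integrable f → ∀ x,
      Integrable fun y => f y * (σ⁻¹ * ricker ((x - y) / σ)) := fun f hf x =>
    hf.mul_bdd (c := σ⁻¹ * C) (by fun_prop) (Eventually.of_forall fun y => by
      rw [norm_mul, Real.norm_of_nonneg (inv_pos.2 hσ).le]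
      exact mul_le_mul_of_nonneg_left (hC _) (inv_pos.2 hσ).le)
  have hadd : ∀ x, convScaled1 (fun y => gauss y + h y) ricker σ x =
      convScaled1 gauss ricker σ x + convScaled1 h ricker σ x := by
    intro x
    unfold convScaled1
    rw [← integral_add (hmul _ integrable_gauss x) (hmul _ hint x)]
    simp_rw [add_mul]
  have hneg : ∀ x, convScaled1 h ricker σ (-x) = convScaled1 h ricker σ x := by
    intro x
    unfold convScaled1
    rw [← integral_neg_eq_self]
    congr 1
    ext y
    rw [heven, ← ricker_neg]
    congr 3
    ring
  set φ : ℝ → ℝ := fun μ => μ ^ 2 - 1 / s ^ 2 + relRicker h σ μ with hφ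
  have hfac : ∀ μ, convScaled1 (fun y => gauss y + h y) ricker σ (s ^ 2 * μ) = 0 ↔ φ μ = 0 := by
    intro μ
    rw [hadd, convScaled1_gauss_ricker hσ, hφ]
    simp only [relRicker, ← hs2]
    have h1 := heatGauss_pos σ (s ^ 2 * μ)
    have h2 : σ ^ 2 * heatGauss σ (s ^ 2 * μ) ≠ 0 := by positivity
    rw [mul_div_cancel_left₀ μ (by positivity), ← mul_eq_zero_iff_left (b := μ ^ 2 - 1 / s ^ 2 + _) h2, mul_add,
      mul_div_cancel₀ _ h2]
  have hφneg : ∀ μ, φ (-μ) = φ μ := by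
    intro μ
    simp only [hφ, relRicker, mul_neg, hneg, neg_sq]
    simp [heatGauss]
  have hφs : φ s⁻¹ = 0 := by
    have h1 : s ^ 2 * s⁻¹ = s := by field_simp
    simp only [hφ, relRicker, ← hs2, h1, hzero]
    simp
  have hmid : ∀ μ ν, 0 ≤ μ → μ < ν → φ ν = 0 → φ μ < 0 := by
    intro μ ν hμ hμν hν
    have hν0 : 0 < ν := hμ.trans_lt hμν
    have hα : 0 < (1 + μ / ν) / 2 := by positivity
    have hβ : 0 < (1 - μ / ν) / 2 := by
      have := (div_lt_one hν0).2 hμν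
      linarith
    have h1 := hrel ν (-ν) _ _ hα.le hβ.le (by ring)
    have h2 : (1 + μ / ν) / 2 * ν + (1 - μ / ν) / 2 * -ν = μ := by
      field_simp
      ring
    have h3 : relRicker h σ (-ν) = relRicker h σ ν := by
      have := hφneg ν
      simp only [hφ, neg_sq] at this
      linarith
    have h4 : (1 + μ / ν) / 2 * ((1 - μ / ν) / 2) * (ν - -ν) ^ 2 = ν ^ 2 - μ ^ 2 := by
      field_simp
      ring
    rw [h2, h3, h4] at h1
    have h5 : relRicker h σ μ ≤ relRicker h σ ν + A * (ν ^ 2 - μ ^ 2) := by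
      linear_combination (abs_le.1 h1).2
    have h6 : 0 < (1 - A) * (ν ^ 2 - μ ^ 2) :=
      mul_pos (by linarith) (by nlinarith)
    simp only [hφ] at hν ⊢
    linarith
  have huniq : ∀ μ, 0 ≤ μ → (φ μ = 0 ↔ μ = s⁻¹) := by
    intro μ hμ
    refine ⟨fun h0 => ?_, fun h0 => h0 ▸ hφs⟩
    rcases lt_trichotomy μ s⁻¹ with h1 | h1 | h1
    · exact absurd h0 (hmid _ _ hμ h1 hφs).ne
    · exact h1
    · exact absurd hφs (hmid _ _ (inv_pos.2 hs).le h1 h0).ne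
  have hall : ∀ μ, φ μ = 0 ↔ |μ| = s⁻¹ := by
    intro μ
    rw [← huniq _ (abs_nonneg μ)]
    rcases abs_choice μ with h1 | h1 <;> rw [h1]
    rw [hφneg]
  ext x
  obtain ⟨μ, rfl⟩ : ∃ μ, x = s ^ 2 * μ := ⟨x / s ^ 2, by field_simp⟩
  simp only [Set.mem_ofPred_eq]
  rw [hfac, hall, convScaled1_gauss_ricker hσ, ← hs2, mul_div_cancel_left₀ μ (by positivity)]
  have h1 := heatGauss_pos σ (s ^ 2 * μ)
  have h2 : σ ^ 2 * heatGauss σ (s ^ 2 * μ) ≠ 0 := by positivity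
  rw [mul_eq_zero, or_iff_right h2, sub_eq_zero,
    ← abs_of_pos (inv_pos.2 hs), ← sq_eq_sq_iff_abs_eq_abs, one_div, inv_pow]

/-- Baire category produces a series in a family of functions that, near `0`, takes both signs
arbitrarily often, provided that each function dominates its predecessors near `0`. -/
lemma exists_tsum_changes_sign (a : ℕ → ℝ → ℝ) (ε : ℕ → ℝ) {r : ℝ} (hr : 0 < r)
    (hε : ∀ n, 0 < ε n) (hεs : Summable ε)
    (hbdd : ∀ σ, 0 < σ → σ ≤ r → ∃ C, ∀ n, |a n σ| ≤ C)
    (hpos : ∀ n σ, 0 < σ → σ ≤ r → 0 < a n σ)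
    (hdom : ∀ m n, m < n → ∃ C, ∀ σ, 0 < σ → σ ≤ r → |a m σ| ≤ C * σ * a n σ) :
    ∃ c : ℕ → ℝ, (∀ n, |c n| ≤ ε n) ∧ ∀ δ, 0 < δ → ∀ e : ℝ, |e| = 1 →
      ∃ σ, 0 < σ ∧ σ < δ ∧ σ ≤ r ∧ 0 < e * ∑' n, c n * a n σ := by
  let X := ∀ n, Set.Icc (-ε n) (ε n)
  let L : ℝ → X → ℝ := fun σ c => ∑' n, (c n : ℝ) * a n σ
  have hL : ∀ σ, 0 < σ → σ ≤ r → Continuous (L σ) := by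
    intro σ hσ hσr
    obtain ⟨C, hC⟩ := hbdd σ hσ hσr
    refine continuous_tsum (u := fun n => ε n * C) (fun n => by fun_prop) (hεs.mul_right C) ?_
    intro n c
    rw [norm_mul]
    exact mul_le_mul (abs_le.2 (c n).2) (hC n) (norm_nonneg _) (hε n).le
  let U : ℕ × Bool → Set X := fun p => {c | ∃ σ, 0 < σ ∧ σ < 1 / ((p.1 : ℝ) + 1) ∧ σ ≤ r ∧
    0 < (if p.2 then 1 else -1) * L σ c}
  have hUo : ∀ p, IsOpen (U p) := by
    intro p
    have : U p = ⋃ σ ∈ {σ : ℝ | 0 < σ ∧ σ < 1 / ((p.1 : ℝ) + 1) ∧ σ ≤ r},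
        {c | 0 < (if p.2 then 1 else -1) * L σ c} := by
      ext c
      simp only [U, Set.mem_iUnion, Set.mem_ofPred_eq, exists_prop, and_assoc]
    rw [this]
    exact isOpen_biUnion fun σ hσ =>
      isOpen_lt continuous_const (continuous_const.mul (hL σ hσ.1 hσ.2.2))
  have hUd : ∀ p, Dense (U p) := by
    intro p c
    obtain ⟨e, he, hep⟩ : ∃ e : ℝ, |e| = 1 ∧ e = if p.2 then 1 else -1 := by
      refine ⟨_, ?_, rfl⟩
      split_ifs <;> simp
    have he2 : e * e = 1 := by rw [← abs_mul_abs_self, he, one_mul]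
    let v : ℕ → ℕ → ℝ := fun N n => if n < N then (c n : ℝ) else if n = N then e * ε N else 0
    have hv : ∀ N n, v N n ∈ Set.Icc (-ε n) (ε n) := by
      intro N n
      rw [Set.mem_Icc, ← abs_le]
      simp only [v]
      split_ifs with h1 h2
      · exact abs_le.2 (c n).2
      · rw [h2, abs_mul, he, one_mul, abs_of_pos (hε N)]
      · simpa using (hε n).le
    have hlim : Tendsto (fun N => (fun n => ⟨v N n, hv N n⟩ : X)) atTop (𝓝 c) := by
      rw [tendsto_pi_nhds]
      intro n
      refine tendsto_const_nhds.congr' ?_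
      filter_upwards [eventually_gt_atTop n] with N hN
      exact Subtype.ext (by simp [v, hN])
    refine mem_closure_of_tendsto hlim (Eventually.of_forall fun N => ?_)
    choose! C hC using fun m (hm : m < N) => hdom m N hm
    set K := ∑ m ∈ Finset.range N, |(c m : ℝ)| * |C m| with hK
    have hK0 : 0 ≤ K := Finset.sum_nonneg fun m _ => by positivity
    have hεN := hε N
    obtain ⟨σ, hσ0, hσ⟩ : ∃ σ : ℝ, 0 < σ ∧ σ < min (min (1 / ((p.1 : ℝ) + 1)) r)
        (ε N / (K + 1)) := exists_between (by positivity)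
    rw [lt_min_iff, lt_min_iff] at hσ
    obtain ⟨⟨hσ1, hσ2⟩, hσ3⟩ := hσ
    refine ⟨σ, hσ0, hσ1, hσ2.le, ?_⟩
    rw [← hep]
    have haN := hpos N σ hσ0 hσ2.le
    have hsum : L σ (fun n => ⟨v N n, hv N n⟩) =
        ∑ m ∈ Finset.range N, (c m : ℝ) * a m σ + e * ε N * a N σ := by
      simp only [L]
      rw [tsum_eq_sum (s := Finset.range (N + 1)), Finset.sum_range_succ]
      · congr 1
        · refine Finset.sum_congr rfl fun m hm => ?_
          simp [v, Finset.mem_range.1 hm]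
        · simp [v]
      · intro n hn
        rw [Finset.mem_range, not_lt] at hn
        simp [v, show ¬ n < N by omega, show n ≠ N by omega]
    have hbd : |∑ m ∈ Finset.range N, (c m : ℝ) * a m σ| ≤ K * (σ * a N σ) := by
      rw [hK, Finset.sum_mul]
      refine (Finset.abs_sum_le_sum_abs _ _).trans (Finset.sum_le_sum fun m hm => ?_)
      rw [abs_mul, mul_assoc]
      refine mul_le_mul_of_nonneg_left ?_ (abs_nonneg _)
      calc |a m σ| ≤ C m * σ * a N σ := hC m (Finset.mem_range.1 hm) σ hσ0 hσ2.le
        _ = C m * (σ * a N σ) := by ring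
        _ ≤ |C m| * (σ * a N σ) := mul_le_mul_of_nonneg_right (le_abs_self _) (by positivity)
    have hlt : K * (σ * a N σ) < ε N * a N σ := by
      rw [lt_div_iff₀ (by positivity)] at hσ3
      nlinarith
    have h1 : |e * ∑ m ∈ Finset.range N, (c m : ℝ) * a m σ| ≤ K * (σ * a N σ) := by
      rw [abs_mul, he, one_mul]
      exact hbd
    rw [hsum]
    have h2 : e * (∑ m ∈ Finset.range N, (c m : ℝ) * a m σ + e * ε N * a N σ) =
        e * ∑ m ∈ Finset.range N, (c m : ℝ) * a m σ + ε N * a N σ := by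
      linear_combination (ε N * a N σ) * he2
    rw [h2]
    linarith [(abs_le.1 h1).1]
  have : Nonempty X := ⟨fun n => ⟨0, by simp [(hε n).le]⟩⟩
  obtain ⟨c, hc⟩ := (dense_iInter_of_isOpen hUo hUd).nonempty
  rw [Set.mem_iInter] at hc
  refine ⟨fun n => c n, fun n => abs_le.2 (c n).2, fun δ hδ e he => ?_⟩
  obtain ⟨N, hN⟩ := exists_nat_one_div_lt hδ
  rcases eq_or_eq_neg_of_abs_eq he with h1 | h1
  · obtain ⟨σ, h2, h3, h4, h5⟩ := hc (N, true)
    exact ⟨σ, h2, h3.trans hN, h4, by simpa [h1] using h5⟩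
  · obtain ⟨σ, h2, h3, h4, h5⟩ := hc (N, false)
    exact ⟨σ, h2, h3.trans hN, h4, by simpa [h1] using h5⟩

lemma exists_even_bump {t : ℝ} (ht : 0 < t) (ht1 : t ≤ 1) :
    ∃ b : ℝ → ℝ, ContDiff ℝ 4 b ∧ (∀ y, b (-y) = b y) ∧ (∀ y, 0 ≤ b y) ∧ (∀ y, b y ≤ 2) ∧
      (∀ y, b y ≠ 0 → 4 + 3 / 4 * t ≤ |y| ∧ |y| ≤ 6) ∧
      ∀ y, 4 + 7 / 8 * t ≤ y → y ≤ 4 + 9 / 8 * t → 1 ≤ b y := by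
  let f : ContDiffBump (4 + t) := ⟨t / 8, t / 4, by positivity, by linarith⟩
  refine ⟨fun y => f y + f (-y), f.contDiff.add (f.contDiff.comp contDiff_neg), fun y => ?_,
    fun y => add_nonneg f.nonneg f.nonneg, fun y => ?_, fun y hy => ?_, fun y h1 h2 => ?_⟩
  · simp only [neg_neg]
    ring
  · have h1 : f y ≤ 1 := f.le_one
    have h2 : f (-y) ≤ 1 := f.le_one
    linarith
  · have hsupp : ∀ z, f z ≠ 0 → 4 + 3 / 4 * t ≤ |z| ∧ |z| ≤ 6 := by
      intro z hz
      have h1 : z ∈ Metric.ball (4 + t) (t / 4) := by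
        have : z ∈ Function.support f := hz
        rwa [f.support_eq] at this
      rw [Metric.mem_ball, Real.dist_eq, abs_lt] at h1
      rw [abs_of_pos (by linarith)]
      constructor <;> linarith
    by_cases h1 : f y = 0
    · have h2 : f (-y) ≠ 0 := fun h2 => hy (by simp [h1, h2])
      simpa using hsupp _ h2
    · exact hsupp y h1
  · have h3 : f y = 1 := f.one_of_mem_closedBall (by
      rw [Metric.mem_closedBall, Real.dist_eq, abs_le]
      change -(t / 8) ≤ _ ∧ _ ≤ t / 8
      constructor <;> linarith)
    have h4 : 0 ≤ f (-y) := f.nonneg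
    linarith

lemma sqrt_one_add_sq_bounds {σ : ℝ} (hσ : 0 < σ) (hσ1 : σ ≤ 1 / 2) :
    1 ≤ Real.sqrt (1 + σ ^ 2) ∧ Real.sqrt (1 + σ ^ 2) ≤ 2 := by
  constructor
  · exact Real.one_le_sqrt.2 (by nlinarith)
  · exact Real.sqrt_le_iff.2 ⟨by norm_num, by nlinarith⟩

lemma norm_convScaled1_ricker_le {b : ℝ → ℝ} {q : ℝ} (hq : 4 ≤ q) (hb : ∀ y, |b y| ≤ 2)
    (hsupp : ∀ y, b y ≠ 0 → q ≤ |y| ∧ |y| ≤ 6) {σ : ℝ} (hσ : 0 < σ) (hσ1 : σ ≤ 1 / 2) :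
    |convScaled1 b ricker σ (Real.sqrt (1 + σ ^ 2))| ≤
      1560 * (Real.sqrt (2 * Real.pi))⁻¹ *
        ((σ⁻¹) ^ 3 * Real.exp (-(q - Real.sqrt (1 + σ ^ 2)) ^ 2 / (2 * σ ^ 2))) := by
  obtain ⟨hs1, hs2⟩ := sqrt_one_add_sq_bounds hσ hσ1
  set s := Real.sqrt (1 + σ ^ 2)
  set B := (Real.sqrt (2 * Real.pi))⁻¹ * Real.exp (-(q - s) ^ 2 / (2 * σ ^ 2)) with hB
  have hB0 : 0 < B := by positivity
  have hpt : ∀ y ∈ Set.Icc (-6 : ℝ) 6,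
      ‖b y * (σ⁻¹ * ricker ((s - y) / σ))‖ ≤ 130 * (σ⁻¹) ^ 3 * B := by
    intro y _
    by_cases hy : b y = 0
    · rw [hy, zero_mul, norm_zero]
      positivity
    obtain ⟨h1, h2⟩ := hsupp y hy
    have h3 : (q - s) ^ 2 ≤ (s - y) ^ 2 := by
      rw [sq_le_sq, abs_of_nonneg (by linarith : 0 ≤ q - s), abs_sub_comm]
      have := abs_sub_abs_le_abs_sub y s
      rw [abs_of_nonneg (by linarith : 0 ≤ s)] at this
      linarith
    have h4 : (s - y) ^ 2 ≤ 64 := by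
      rw [abs_le] at h2
      nlinarith
    have h5 : |((s - y) / σ) ^ 2 - 1| ≤ 65 * (σ⁻¹) ^ 2 := by
      have h6 : 1 ≤ (σ⁻¹) ^ 2 := by
        have : 1 ≤ σ⁻¹ := (one_le_inv₀ hσ).2 (by linarith)
        nlinarith
      have h7 : ((s - y) / σ) ^ 2 ≤ 64 * (σ⁻¹) ^ 2 := by
        rw [div_eq_mul_inv, mul_pow]
        exact mul_le_mul_of_nonneg_right h4 (by positivity)
      rw [abs_le]
      constructor <;> nlinarith [sq_nonneg ((s - y) / σ)]
    have h8 : gauss ((s - y) / σ) ≤ B := by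
      rw [gauss, hB]
      refine mul_le_mul_of_nonneg_left (Real.exp_le_exp.2 ?_) (by positivity)
      have h9 : -((s - y) / σ) ^ 2 / 2 = -(s - y) ^ 2 / (2 * σ ^ 2) := by
        field_simp
      rw [h9]
      gcongr
    rw [ricker, norm_mul, norm_mul, norm_mul, Real.norm_of_nonneg (inv_pos.2 hσ).le,
      Real.norm_of_nonneg (gauss_pos _).le, Real.norm_eq_abs, Real.norm_eq_abs]
    calc |b y| * (σ⁻¹ * (|((s - y) / σ) ^ 2 - 1| * gauss ((s - y) / σ)))
        ≤ 2 * (σ⁻¹ * (65 * (σ⁻¹) ^ 2 * B)) := by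
          have := gauss_pos ((s - y) / σ)
          gcongr
          exact hb y
      _ = 130 * (σ⁻¹) ^ 3 * B := by ring
  have hset : ∫ y in Set.Icc (-6 : ℝ) 6, b y * (σ⁻¹ * ricker ((s - y) / σ)) =
      convScaled1 b ricker σ s := by
    refine setIntegral_eq_integral_of_forall_compl_eq_zero fun y hy => ?_
    by_contra hne
    exact hy (abs_le.1 (hsupp y (left_ne_zero_of_mul hne)).2)
  have h := norm_setIntegral_le_of_norm_le_const (μ := volume) (by simp) hpt
  rw [hset, Real.norm_eq_abs] at h
  refine h.trans_eq ?_
  simp only [Real.volume_real_Icc, hB]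
  norm_num
  ring

lemma le_convScaled1_ricker {b : ℝ → ℝ} (hcont : Continuous b) (hb : ∀ y, 0 ≤ b y)
    (hsupp : ∀ y, b y ≠ 0 → 4 ≤ |y| ∧ |y| ≤ 6) {u v : ℝ} (hu : 4 ≤ u) (huv : u ≤ v)
    (hone : ∀ y, u ≤ y → y ≤ v → 1 ≤ b y) {σ : ℝ} (hσ : 0 < σ) (hσ1 : σ ≤ 1 / 2) :
    (v - u) * ((Real.sqrt (2 * Real.pi))⁻¹ *
      Real.exp (-(v - Real.sqrt (1 + σ ^ 2)) ^ 2 / (2 * σ ^ 2))) ≤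
      convScaled1 b ricker σ (Real.sqrt (1 + σ ^ 2)) := by
  obtain ⟨hs1, hs2⟩ := sqrt_one_add_sq_bounds hσ hσ1
  set s := Real.sqrt (1 + σ ^ 2)
  set B := (Real.sqrt (2 * Real.pi))⁻¹ * Real.exp (-(v - s) ^ 2 / (2 * σ ^ 2)) with hB
  have hcr := continuous_ricker
  have hc : HasCompactSupport b :=
    HasCompactSupport.intro (isCompact_Icc (a := (-6 : ℝ)) (b := 6)) fun y hy => by
      by_contra hne
      exact hy (abs_le.1 (hsupp y hne).2)
  have hsq : ∀ y, 4 ≤ |y| → 2 ≤ ((s - y) / σ) ^ 2 := by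
    intro y hy
    have h1 : 4 ≤ (s - y) ^ 2 := by
      rcases le_abs.1 hy with h | h <;> nlinarith
    rw [div_pow, le_div_iff₀ (by positivity)]
    nlinarith
  set w : ℝ → ℝ := fun y => b y * (σ⁻¹ * ricker ((s - y) / σ)) with hw
  have hw0 : ∀ y, 0 ≤ w y := by
    intro y
    by_cases hy : b y = 0
    · simp [hw, hy]
    · have h1 := hsq y (hsupp y hy).1
      refine mul_nonneg (hb y) (mul_nonneg (inv_pos.2 hσ).le (mul_nonneg ?_ (gauss_pos _).le))
      linarith
  have hwi : Integrable w := by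
    have : Continuous w := by fun_prop
    exact this.integrable_of_hasCompactSupport hc.mul_right
  have hpt : ∀ y ∈ Set.Icc u v, B ≤ w y := by
    intro y hy
    have h1 := hsq y (le_abs.2 (Or.inl (hu.trans hy.1)))
    have h2 : B ≤ gauss ((s - y) / σ) := by
      rw [gauss, hB]
      refine mul_le_mul_of_nonneg_left (Real.exp_le_exp.2 ?_) (by positivity)
      have h9 : -((s - y) / σ) ^ 2 / 2 = -(s - y) ^ 2 / (2 * σ ^ 2) := by
        field_simp
      rw [h9]
      have : (s - y) ^ 2 ≤ (v - s) ^ 2 := by nlinarith [hy.1, hy.2]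
      gcongr
    have h3 : gauss ((s - y) / σ) ≤ ricker ((s - y) / σ) := by
      rw [ricker]
      nlinarith [gauss_pos ((s - y) / σ)]
    have h4 : 1 ≤ σ⁻¹ := (one_le_inv₀ hσ).2 (by linarith)
    have h5 := (gauss_pos ((s - y) / σ)).trans_le h3
    calc B ≤ ricker ((s - y) / σ) := h2.trans h3
      _ ≤ σ⁻¹ * ricker ((s - y) / σ) := le_mul_of_one_le_left h5.le h4
      _ ≤ b y * (σ⁻¹ * ricker ((s - y) / σ)) :=
        le_mul_of_one_le_left (by positivity) (hone y hy.1 hy.2)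
  calc (v - u) * B = ∫ _ in Set.Icc u v, B := by
        rw [setIntegral_const, Real.volume_real_Icc_of_le huv, smul_eq_mul]
    _ ≤ ∫ y in Set.Icc u v, w y :=
        setIntegral_mono_on (integrableOn_const (by simp)) hwi.integrableOn measurableSet_Icc hpt
    _ ≤ ∫ y, w y := setIntegral_le_integral hwi (Eventually.of_forall hw0)

lemma exists_convScaled1_ricker_le_mul {b b' : ℝ → ℝ} {q u v : ℝ} (hcont : Continuous b)
    (hb : ∀ y, 0 ≤ b y) (hsupp : ∀ y, b y ≠ 0 → 4 ≤ |y| ∧ |y| ≤ 6) (hu : 4 ≤ u) (huv : u < v)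
    (hone : ∀ y, u ≤ y → y ≤ v → 1 ≤ b y) (hvq : v < q) (hb' : ∀ y, |b' y| ≤ 2)
    (hsupp' : ∀ y, b' y ≠ 0 → q ≤ |y| ∧ |y| ≤ 6) :
    ∃ C, ∀ σ, 0 < σ → σ ≤ 1 / 2 → |convScaled1 b' ricker σ (Real.sqrt (1 + σ ^ 2))| ≤
      C * σ * convScaled1 b ricker σ (Real.sqrt (1 + σ ^ 2)) := by
  have hδ : 0 < q - v := sub_pos.2 hvq
  have hvu : 0 < v - u := sub_pos.2 huv
  refine ⟨3120 / ((q - v) ^ 2 * (v - u)), fun σ hσ hσ1 => ?_⟩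
  have hup := norm_convScaled1_ricker_le (by linarith) hb' hsupp' hσ hσ1
  have hlo := le_convScaled1_ricker hcont hb hsupp hu huv.le hone hσ hσ1
  obtain ⟨hs1, hs2⟩ := sqrt_one_add_sq_bounds hσ hσ1
  set s := Real.sqrt (1 + σ ^ 2)
  set p := (Real.sqrt (2 * Real.pi))⁻¹
  have hp : 0 < p := by positivity
  have hexp : Real.exp (-(q - s) ^ 2 / (2 * σ ^ 2)) ≤
      2 * σ ^ 4 / (q - v) ^ 2 * Real.exp (-(v - s) ^ 2 / (2 * σ ^ 2)) := by
    set x := (q - v) / σ ^ 2 with hx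
    have hx0 : 0 < x := by positivity
    have h1 : -(q - s) ^ 2 / (2 * σ ^ 2) ≤ -x + -(v - s) ^ 2 / (2 * σ ^ 2) := by
      have e : -x + -(v - s) ^ 2 / (2 * σ ^ 2) =
          -(2 * (q - v) + (v - s) ^ 2) / (2 * σ ^ 2) := by
        rw [hx]
        field_simp
        ring
      have : 2 * (q - v) + (v - s) ^ 2 ≤ (q - s) ^ 2 := by nlinarith
      rw [e]
      gcongr
    have h2 : x ^ 2 / 2 ≤ Real.exp x := by
      have := Real.quadratic_le_exp_of_nonneg hx0.le
      linarith
    have h3 : Real.exp (-x) ≤ 2 * σ ^ 4 / (q - v) ^ 2 := by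
      rw [Real.exp_neg]
      calc (Real.exp x)⁻¹ ≤ (x ^ 2 / 2)⁻¹ := inv_anti₀ (by positivity) h2
        _ = _ := by rw [hx]; field_simp
    calc _ ≤ Real.exp (-x + -(v - s) ^ 2 / (2 * σ ^ 2)) := Real.exp_le_exp.2 h1
      _ = Real.exp (-x) * Real.exp (-(v - s) ^ 2 / (2 * σ ^ 2)) := Real.exp_add _ _
      _ ≤ _ := mul_le_mul_of_nonneg_right h3 (Real.exp_pos _).le
  calc _ ≤ _ := hup
    _ ≤ 1560 * p * ((σ⁻¹) ^ 3 *
        (2 * σ ^ 4 / (q - v) ^ 2 * Real.exp (-(v - s) ^ 2 / (2 * σ ^ 2)))) := by gcongr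
    _ = 3120 / ((q - v) ^ 2 * (v - u)) * σ *
        ((v - u) * (p * Real.exp (-(v - s) ^ 2 / (2 * σ ^ 2)))) := by
      field_simp
      norm_num
    _ ≤ _ := mul_le_mul_of_nonneg_left hlo (by positivity)

lemma ConvexityDefectLE.hasSum {φ : ℕ → ℝ → ℝ} {Φ : ℝ → ℝ} {A c u : ℕ → ℝ} {U : ℝ}
    (hφ : ∀ n, ConvexityDefectLE (A n) (φ n)) (hu : ∀ n, |c n| * A n ≤ u n) (hU : HasSum u U)
    (hΦ : ∀ x, HasSum (fun n => c n * φ n x) (Φ x)) : ConvexityDefectLE U Φ := by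
  intro a b α β hα hβ hαβ
  have h1 := ((hΦ (α * a + β * b)).sub ((hΦ a).mul_left α)).sub ((hΦ b).mul_left β)
  refine h1.norm_le_of_bounded (hU.mul_right (α * β * (a - b) ^ 2)) fun n => ?_
  have h2 : c n * φ n (α * a + β * b) - α * (c n * φ n a) - β * (c n * φ n b) =
      c n * (φ n (α * a + β * b) - α * φ n a - β * φ n b) := by ring
  rw [h2, norm_mul, Real.norm_eq_abs, Real.norm_eq_abs]
  calc _ ≤ |c n| * (A n * (α * β * (a - b) ^ 2)) :=
        mul_le_mul_of_nonneg_left (hφ n a b α β hα hβ hαβ) (abs_nonneg _)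
    _ = |c n| * A n * (α * β * (a - b) ^ 2) := by ring
    _ ≤ _ := mul_le_mul_of_nonneg_right (hu n) (by positivity)

lemma hasSum_convScaled1_ricker {b : ℕ → ℝ → ℝ} {c ε : ℕ → ℝ} (hcont : ∀ n, Continuous (b n))
    (hb : ∀ n y, |b n y| ≤ 2) (hc : ∀ n, |c n| ≤ ε n) (hε : Summable ε) {σ : ℝ} (hσ : 0 < σ)
    (x : ℝ) :
    HasSum (fun n => c n * convScaled1 (b n) ricker σ x)
      (convScaled1 (fun y => ∑' n, c n * b n y) ricker σ x) := by
  set k : ℝ → ℝ := fun y => σ⁻¹ * ricker ((x - y) / σ) with hk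
  have hki : Integrable k :=
    ((integrable_ricker.comp_div hσ.ne').comp_sub_left x).const_mul σ⁻¹
  have hbk : ∀ n, Integrable fun y => c n * (b n y * k y) := fun n =>
    (hki.bdd_mul (hcont n).aestronglyMeasurable (Eventually.of_forall (hb n))).const_mul (c n)
  have hε0 : ∀ n, 0 ≤ ε n := fun n => (abs_nonneg _).trans (hc n)
  have hpt : ∀ n y, ‖c n * (b n y * k y)‖ ≤ ε n * 2 * ‖k y‖ := by
    intro n y
    rw [norm_mul, norm_mul, ← mul_assoc]
    gcongr
    · exact hε0 n
    · exact hc n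
    · exact hb n y
  have hsum : Summable fun n => ∫ y, ‖c n * (b n y * k y)‖ := by
    refine Summable.of_nonneg_of_le (fun n => integral_nonneg fun y => norm_nonneg _)
      (fun n => ?_) ((hε.mul_right 2).mul_right (∫ y, ‖k y‖))
    rw [← integral_const_mul]
    exact integral_mono (hbk n).norm (hki.norm.const_mul _) (hpt n)
  have h := hasSum_integral_of_summable_integral_norm hbk hsum
  have h1 : ∀ n, ∫ y, c n * (b n y * k y) = c n * convScaled1 (b n) ricker σ x := fun n =>
    integral_const_mul _ _
  have h2 : ∫ y, ∑' n, c n * (b n y * k y) =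
      convScaled1 (fun y => ∑' n, c n * b n y) ricker σ x := by
    unfold convScaled1
    congr 1
    ext y
    rw [← tsum_mul_right]
    simp_rw [hk, mul_assoc]
  simpa only [h1, h2] using h

lemma continuousOn_convScaled1_ricker {h : ℝ → ℝ} (hcont : Continuous h)
    (hc : HasCompactSupport h) :
    ContinuousOn (fun σ => convScaled1 h ricker σ (Real.sqrt (1 + σ ^ 2))) (Set.Ioi 0) := by
  have hcr := continuous_ricker
  refine continuousOn_integral_of_compact_support hc.isCompact ?_ ?_
  · have h0 : ∀ p ∈ Set.Ioi (0 : ℝ) ×ˢ (Set.univ : Set ℝ), p.1 ≠ 0 := fun p hp => (hp.1 : 0 < p.1).ne'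
    have h1 : ContinuousOn (fun p : ℝ × ℝ => p.1⁻¹) (Set.Ioi (0 : ℝ) ×ˢ (Set.univ : Set ℝ)) :=
      continuousOn_fst.inv₀ h0
    have h2 : ContinuousOn (fun p : ℝ × ℝ => (Real.sqrt (1 + p.1 ^ 2) - p.2) / p.1)
        (Set.Ioi (0 : ℝ) ×ˢ (Set.univ : Set ℝ)) :=
      ContinuousOn.div (by fun_prop) continuousOn_fst h0
    exact (hcont.comp continuous_snd).continuousOn.mul (h1.mul (hcr.comp_continuousOn h2))
  · intro σ y _ hy
    rw [image_eq_zero_of_notMem_tsupport hy, zero_mul]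

/-- **Marr conjecture in one dimension, part (b)**: unique determination fails when the
scales tend only to zero.  There is a compactly supported integrable perturbation `h`
(not a.e. zero) and a strictly decreasing sequence of scales `σ_k → 0` such that the
Ricker wavelet transforms of `G + h` and `G` have identical zero sets at every scale
`σ_k`. -/
theorem marr_one_dim_b :
    ∃ (h : ℝ → ℝ) (σ : ℕ → ℝ),
      HasCompactSupport h ∧ Integrable h ∧ ¬ (∀ᵐ x : ℝ, h x = 0) ∧
      StrictAnti σ ∧ (∀ k, 0 < σ k) ∧ Tendsto σ atTop (nhds 0) ∧
      ∀ k, {x : ℝ | convScaled1 (fun y => gauss y + h y) ricker (σ k) x = 0} =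
        {x : ℝ | convScaled1 gauss ricker (σ k) x = 0} := by
  set t : ℕ → ℝ := fun n => (1 / 2) ^ n with ht
  have ht0 : ∀ n, 0 < t n := fun n => by positivity
  have ht1 : ∀ n, t n ≤ 1 := fun n => pow_le_one₀ (by norm_num) (by norm_num)
  choose b hbd heven hb0 hb2 hsupp hone using fun n => exists_even_bump (ht0 n) (ht1 n)
  have hbcont : ∀ n, Continuous (b n) := fun n => (hbd n).continuous
  have habs : ∀ n y, |b n y| ≤ 2 := fun n y => by
    rw [abs_of_nonneg (hb0 n y)]
    exact hb2 n y
  have hsupp4 : ∀ n y, b n y ≠ 0 → 4 ≤ |y| ∧ |y| ≤ 6 := fun n y hy =>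
    ⟨by linarith [(hsupp n y hy).1, ht0 n], (hsupp n y hy).2⟩
  have hbz : ∀ n, ∀ y ∉ Set.Icc (-6 : ℝ) 6, b n y = 0 := fun n y hy => by
    by_contra hne
    exact hy (abs_le.1 (hsupp n y hne).2)
  choose A hA0 hA using fun n => (hbd n).exists_convexityDefectLE_relRicker
    (HasCompactSupport.intro isCompact_Icc (hbz n))
  set ε : ℕ → ℝ := fun n => (1 / 2) ^ n / 4 / (1 + A n) with hε
  have hε0 : ∀ n, 0 < ε n := fun n => by
    have := hA0 n
    positivity
  have hgeom : HasSum (fun n : ℕ => ((1 : ℝ) / 2) ^ n / 4) (2 / 4) := hasSum_geometric_two.div_const 4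
  have hεs : Summable ε := by
    refine Summable.of_nonneg_of_le (fun n => (hε0 n).le) (fun n => ?_) hgeom.summable
    exact div_le_self (by positivity) (by linarith [hA0 n])
  set a : ℕ → ℝ → ℝ := fun n σ => convScaled1 (b n) ricker σ (Real.sqrt (1 + σ ^ 2)) with ha
  obtain ⟨c, hcε, hc⟩ := exists_tsum_changes_sign a ε (r := 1 / 2) (by norm_num) hε0 hεs
    (fun σ hσ hσ1 => ⟨_, fun n => norm_convScaled1_ricker_le le_rfl (habs n) (hsupp4 n) hσ hσ1⟩)
    (fun n σ hσ hσ1 => by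
      have ht := ht0 n
      refine lt_of_lt_of_le ?_ (le_convScaled1_ricker (hbcont n) (hb0 n) (hsupp4 n)
        (u := 4 + 7 / 8 * t n) (v := 4 + 9 / 8 * t n) (by linarith) (by linarith) (hone n) hσ hσ1)
      exact mul_pos (by linarith) (by positivity))
    (fun m n hmn => by
      have htn := ht0 n
      have hmn' : t n ≤ t m / 2 := by
        have h1 : t n ≤ t (m + 1) := pow_le_pow_of_le_one (by norm_num) (by norm_num) hmn
        have h2 : t (m + 1) = t m / 2 := by
          simp only [ht]
          ring
        linarith
      exact exists_convScaled1_ricker_le_mul (hbcont n) (hb0 n) (hsupp4 n)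
        (u := 4 + 7 / 8 * t n) (v := 4 + 9 / 8 * t n) (by linarith) (by linarith) (hone n)
        (by linarith) (habs m) (hsupp m))
  set h : ℝ → ℝ := fun y => ∑' n, c n * b n y with hh
  have hcompact : HasCompactSupport h :=
    HasCompactSupport.intro (isCompact_Icc (a := (-6 : ℝ)) (b := 6)) fun y hy => by
      simp [hh, hbz _ y hy]
  have hcont : Continuous h :=
    continuous_tsum (fun n => (hbcont n).const_mul (c n)) (hεs.mul_right 2) fun n y => by
      rw [norm_mul]
      exact mul_le_mul (hcε n) (habs n y) (norm_nonneg _) (hε0 n).le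
  have hint : Integrable h := hcont.integrable_of_hasCompactSupport hcompact
  have hheven : ∀ y, h (-y) = h y := fun y => by simp [hh, heven]
  have hsum : ∀ σ, 0 < σ → ∀ x, HasSum (fun n => c n * convScaled1 (b n) ricker σ x)
      (convScaled1 h ricker σ x) := fun σ hσ x =>
    hasSum_convScaled1_ricker hbcont habs hcε hεs hσ x
  have hdefect : ∀ σ, 0 < σ → ConvexityDefectLE (2 / 4) (relRicker h σ) := fun σ hσ => by
    refine ConvexityDefectLE.hasSum (c := c) (fun n => hA n σ hσ) (fun n => ?_) hgeom fun μ => ?_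
    · calc |c n| * A n ≤ ε n * (1 + A n) :=
            mul_le_mul (hcε n) (by linarith) (hA0 n) (hε0 n).le
        _ = _ := div_mul_cancel₀ _ (by linarith [hA0 n])
    · simpa only [relRicker, mul_div_assoc] using (hsum σ hσ ((1 + σ ^ 2) * μ)).div_const
        (σ ^ 2 * heatGauss σ ((1 + σ ^ 2) * μ))
  set F : ℝ → ℝ := fun σ => convScaled1 h ricker σ (Real.sqrt (1 + σ ^ 2)) with hF
  have hFsum : ∀ σ, 0 < σ → ∑' n, c n * a n σ = F σ := fun σ hσ => (hsum σ hσ _).tsum_eq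
  have hzero : ∀ δ, 0 < δ → ∃ σ, 0 < σ ∧ σ < δ ∧ F σ = 0 := by
    intro δ hδ
    obtain ⟨σ₁, h1, h1δ, -, hp⟩ := hc δ hδ 1 (by simp)
    obtain ⟨σ₂, h2, h2δ, -, hn⟩ := hc δ hδ (-1) (by simp)
    rw [hFsum _ h1] at hp
    rw [hFsum _ h2] at hn
    have hFc : ContinuousOn F (Set.Ioo 0 δ) :=
      (continuousOn_convScaled1_ricker hcont hcompact).mono Set.Ioo_subset_Ioi_self
    obtain ⟨σ, hσ, hFσ⟩ := isPreconnected_Ioo.intermediate_value (Set.mem_Ioo.2 ⟨h2, h2δ⟩)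
      (Set.mem_Ioo.2 ⟨h1, h1δ⟩) hFc
      (Set.mem_Icc.2 ⟨by linarith, by linarith⟩ : (0 : ℝ) ∈ Set.Icc (F σ₂) (F σ₁))
    exact ⟨σ, hσ.1, hσ.2, hFσ⟩
  obtain ⟨σ, hanti, hpos, hlim, hmem⟩ :=
    IsGLB.exists_seq_strictAnti_tendsto_of_notMem (t := {σ : ℝ | 0 < σ ∧ F σ = 0}) (x := 0)
      ⟨fun σ hσ => hσ.1.le, fun y hy => by
        by_contra! hlt
        obtain ⟨σ, h1, h2, h3⟩ := hzero y hlt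
        exact absurd (hy ⟨h1, h3⟩) (not_le.2 h2)⟩
      (fun h0 => lt_irrefl _ h0.1)
      (by
        obtain ⟨σ, h1, -, h3⟩ := hzero 1 one_pos
        exact ⟨σ, h1, h3⟩)
  refine ⟨h, σ, hcompact, hint, fun hae => ?_, hanti, hpos, hlim, fun k =>
    zero_set_add_eq hint hheven (hpos k) (by norm_num) (hdefect _ (hpos k)) (hmem k).2⟩
  obtain ⟨σ₁, h1, -, -, hp⟩ := hc 1 one_pos 1 (by simp)
  rw [hFsum _ h1, one_mul] at hp
  refine hp.ne' (integral_eq_zero_of_ae ?_)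
  filter_upwards [hae] with y hy
  exact mul_eq_zero_of_left hy _
end
end

section
/- (Locally uniform asymptotic moment expansion of convolutions) Let f : ℝ^d → ℝ be an integrable function of exponential order, with moments μ_α = ∫_{ℝ^d} x^α f(x) dx, and let ψ : ℝ^d → ℝ be smooth with derivatives of slower-than-exponential growth. Then for every integer N ≥ 0 and every compact set K ⊆ ℝ^d, sup_{w∈K} | σ^{N+d} ( (f*ψ_σ)(σw) − Σ_{0≤|α|≤N} ((−1)^{|α|}/α!) μ_α σ^{−|α|−d} ∂^α ψ(w) ) | → 0 as σ → ∞. -/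
open MeasureTheory Real Filter Topology

noncomputable section

/-- Partial derivative of `ψ : ℝ^d → ℝ` in the `i`-th coordinate direction. -/
def pd {d : ℕ} (i : Fin d) (ψ : EuclideanSpace ℝ (Fin d) → ℝ) :
    EuclideanSpace ℝ (Fin d) → ℝ :=
  fun x => fderiv ℝ ψ x (EuclideanSpace.single i 1)

/-- Mixed partial derivative `∂^α ψ` for a multiindex `α`. -/
def mderiv {d : ℕ} (α : Fin d → ℕ) (ψ : EuclideanSpace ℝ (Fin d) → ℝ) :
    EuclideanSpace ℝ (Fin d) → ℝ :=
  (List.finRange d).foldr (fun i F => (pd i)^[α i] F) ψ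

/-- `f` is integrable and of exponential order. -/
def ExpOrder {d : ℕ} (f : EuclideanSpace ℝ (Fin d) → ℝ) : Prop :=
  Integrable f ∧ ∃ C γ : ℝ, 0 < C ∧ 0 < γ ∧
    ∀ᵐ x : EuclideanSpace ℝ (Fin d), |f x| ≤ C * Real.exp (-γ * ‖x‖)

/-- `ψ` is smooth and all its derivatives have slower-than-exponential growth. -/
def SlowGrowth {d : ℕ} (ψ : EuclideanSpace ℝ (Fin d) → ℝ) : Prop :=
  ContDiff ℝ (⊤ : ℕ∞) ψ ∧ ∀ γ : ℝ, 0 < γ → ∀ α : Fin d → ℕ,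
    Tendsto (fun x : EuclideanSpace ℝ (Fin d) => Real.exp (-γ * ‖x‖) * mderiv α ψ x)
      (cocompact (EuclideanSpace ℝ (Fin d))) (nhds 0)

/-- The wavelet transform `(f * ψ_σ)(x)` with `ψ_σ(x) = σ^{-d} ψ(x/σ)`. -/
def convScaled {d : ℕ} (f ψ : EuclideanSpace ℝ (Fin d) → ℝ) (σ : ℝ)
    (x : EuclideanSpace ℝ (Fin d)) : ℝ :=
  ∫ y, f y * ((σ ^ d)⁻¹ * ψ (σ⁻¹ • (x - y)))

/-- The `α`-th moment `μ_α = ∫ x^α f(x) dx`. -/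
def momentD {d : ℕ} (f : EuclideanSpace ℝ (Fin d) → ℝ) (α : Fin d → ℕ) : ℝ :=
  ∫ x : EuclideanSpace ℝ (Fin d), (∏ i, (x i) ^ (α i)) * f x

/-- The finite set of multiindices `α` with `|α| ≤ N`. -/
def multiindicesLe (d N : ℕ) : Finset (Fin d → ℕ) :=
  (Finset.Iic (fun _ => N : Fin d → ℕ)).filter (fun α => ∑ i, α i ≤ N)

section PartialDerivatives

variable {d : ℕ} {ψ : EuclideanSpace ℝ (Fin d) → ℝ}

lemma contDiff_pd (hψ : ContDiff ℝ (⊤ : ℕ∞) ψ) (i : Fin d) : ContDiff ℝ (⊤ : ℕ∞) (pd i ψ) := by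
  unfold pd
  exact (hψ.fderiv_right (m := (⊤ : ℕ∞)) (by simp)).clm_apply contDiff_const

lemma contDiff_pd_iterate (hψ : ContDiff ℝ (⊤ : ℕ∞) ψ) (i : Fin d) (n : ℕ) :
    ContDiff ℝ (⊤ : ℕ∞) ((pd i)^[n] ψ) := by
  induction n with
  | zero => exact hψ
  | succ n ih => rw [Function.iterate_succ_apply']; exact contDiff_pd ih i

lemma contDiff_foldr_pd (hψ : ContDiff ℝ (⊤ : ℕ∞) ψ) (α : Fin d → ℕ) (l : List (Fin d)) :
    ContDiff ℝ (⊤ : ℕ∞) (l.foldr (fun i F => (pd i)^[α i] F) ψ) := by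
  induction l with
  | nil => exact hψ
  | cons j l ih => exact contDiff_pd_iterate ih j (α j)

lemma contDiff_mderiv (hψ : ContDiff ℝ (⊤ : ℕ∞) ψ) (α : Fin d → ℕ) :
    ContDiff ℝ (⊤ : ℕ∞) (mderiv α ψ) :=
  contDiff_foldr_pd hψ α _

lemma pd_comm (hψ : ContDiff ℝ (⊤ : ℕ∞) ψ) (i j : Fin d) : pd i (pd j ψ) = pd j (pd i ψ) := by
  have hd : Differentiable ℝ (fderiv ℝ ψ) :=
    (hψ.fderiv_right (m := (⊤ : ℕ∞)) (by simp)).differentiable (by simp)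
  funext x
  have key (u v : EuclideanSpace ℝ (Fin d)) :
      fderiv ℝ (fun y => fderiv ℝ ψ y u) x v = fderiv ℝ (fderiv ℝ ψ) x v u := by
    rw [fderiv_clm_apply (hd x) (differentiableAt_const _)]
    simp
  change fderiv ℝ (fun y => fderiv ℝ ψ y _) x _ = fderiv ℝ (fun y => fderiv ℝ ψ y _) x _
  rw [key, key]
  refine (hψ.contDiffAt.isSymmSndFDerivAt ?_) _ _
  rw [minSmoothness_of_isRCLikeNormedField]
  exact WithTop.coe_le_coe.2 (le_top : (2 : ℕ∞) ≤ ⊤)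

lemma pd_iterate_comm (hψ : ContDiff ℝ (⊤ : ℕ∞) ψ) (i j : Fin d) (n : ℕ) :
    pd i ((pd j)^[n] ψ) = (pd j)^[n] (pd i ψ) := by
  induction n with
  | zero => rfl
  | succ n ih =>
    rw [Function.iterate_succ_apply', Function.iterate_succ_apply',
      pd_comm (contDiff_pd_iterate hψ j n), ih]

lemma foldr_pd_congr {α β : Fin d → ℕ} {l : List (Fin d)} (h : ∀ i ∈ l, α i = β i) :
    l.foldr (fun i F => (pd i)^[α i] F) ψ = l.foldr (fun i F => (pd i)^[β i] F) ψ := by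
  induction l with
  | nil => rfl
  | cons j l ih =>
    simp only [List.foldr_cons]
    rw [ih fun i hi => h i (List.mem_cons_of_mem _ hi), h j List.mem_cons_self]

lemma pd_foldr_pd (hψ : ContDiff ℝ (⊤ : ℕ∞) ψ) (α : Fin d → ℕ) (i : Fin d) {l : List (Fin d)}
    (hl : l.Nodup) (hi : i ∈ l) :
    pd i (l.foldr (fun i F => (pd i)^[α i] F) ψ) =
      l.foldr (fun j F => (pd j)^[(α + Pi.single i 1 : Fin d → ℕ) j] F) ψ := by
  induction l with
  | nil => simp at hi
  | cons j l ih =>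
    simp only [List.foldr_cons]
    rw [List.nodup_cons] at hl
    rcases eq_or_ne i j with rfl | hij
    · rw [← Function.iterate_succ_apply' (pd i), foldr_pd_congr (β := α + Pi.single i 1)]
      · simp
      · intro k hk
        have : k ≠ i := fun h => hl.1 (h ▸ hk)
        simp [this]
    · rw [pd_iterate_comm (contDiff_foldr_pd hψ α l),
        ih hl.2 ((List.mem_cons.1 hi).resolve_left hij)]
      simp [hij.symm]

lemma pd_mderiv (hψ : ContDiff ℝ (⊤ : ℕ∞) ψ) (α : Fin d → ℕ) (i : Fin d) :
    pd i (mderiv α ψ) = mderiv (α + Pi.single i 1) ψ :=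
  pd_foldr_pd hψ α i (List.nodup_finRange d) (List.mem_finRange i)

lemma mderiv_zero : mderiv (0 : Fin d → ℕ) ψ = ψ := by
  simp [mderiv]

lemma hasDerivAt_comp_line (hψ : ContDiff ℝ (⊤ : ℕ∞) ψ) (w h : EuclideanSpace ℝ (Fin d)) (t : ℝ) :
    HasDerivAt (fun t : ℝ => ψ (w + t • h)) (∑ i, h i * pd i ψ (w + t • h)) t := by
  have h1 : HasDerivAt (fun t : ℝ => w + t • h) h t := by
    simpa using ((hasDerivAt_id t).smul_const h).const_add w
  have h2 := ((hψ.differentiable (by simp)) (w + t • h)).hasFDerivAt.comp_hasDerivAt t h1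
  refine h2.congr_deriv ?_
  have h3 := congrArg (fderiv ℝ ψ (w + t • h)) ((EuclideanSpace.basisFun (Fin d) ℝ).sum_repr h)
  rw [← h3]
  simp [pd]

/-- The constant-coefficient differential operator with symbol `p`, applied to `ψ`. -/
def symbolOp (ψ : EuclideanSpace ℝ (Fin d) → ℝ) :
    MvPolynomial (Fin d) ℝ →ₗ[ℝ] (EuclideanSpace ℝ (Fin d) → ℝ) :=
  (MvPolynomial.basisMonomials (Fin d) ℝ).constr ℝ (fun s => mderiv (⇑s) ψ)

lemma symbolOp_monomial (s : Fin d →₀ ℕ) (a : ℝ) :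
    symbolOp ψ (MvPolynomial.monomial s a) = a • mderiv (⇑s) ψ := by
  have h : MvPolynomial.monomial s a = a • MvPolynomial.basisMonomials (Fin d) ℝ s := by
    simp [MvPolynomial.smul_monomial]
  rw [h, map_smul, symbolOp, Module.Basis.constr_basis]

lemma hasDerivAt_symbolOp (hψ : ContDiff ℝ (⊤ : ℕ∞) ψ) (w h : EuclideanSpace ℝ (Fin d))
    (p : MvPolynomial (Fin d) ℝ) (t : ℝ) :
    HasDerivAt (fun t : ℝ => symbolOp ψ p (w + t • h))
      (symbolOp ψ ((∑ i, MvPolynomial.monomial (Finsupp.single i 1) (h i)) * p) (w + t • h)) t := by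
  induction p using MvPolynomial.induction_on' with
  | add p q hp hq => simpa only [map_add, mul_add, Pi.add_apply] using hp.fun_add hq
  | monomial s a =>
    simp only [Finset.sum_mul, MvPolynomial.monomial_mul, map_sum, symbolOp_monomial,
      Finset.sum_apply, Pi.smul_apply, smul_eq_mul]
    refine ((hasDerivAt_comp_line (contDiff_mderiv hψ (⇑s)) w h t).const_mul a).congr_deriv ?_
    rw [Finset.mul_sum]
    refine Finset.sum_congr rfl fun i _ => ?_
    rw [pd_mderiv hψ, Finsupp.coe_add, add_comm, Finsupp.single_eq_pi_single]
    ring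

lemma symbolOp_pow (h : EuclideanSpace ℝ (Fin d)) (n : ℕ) (x : EuclideanSpace ℝ (Fin d)) :
    symbolOp ψ ((∑ i, MvPolynomial.monomial (Finsupp.single i 1) (h i)) ^ n) x =
      ∑ α ∈ Finset.univ.piAntidiag n,
        (Nat.multinomial Finset.univ α : ℝ) * (∏ i, h i ^ α i) * mderiv α ψ x := by
  rw [Finset.sum_pow_eq_sum_piAntidiag, map_sum, Finset.sum_apply]
  refine Finset.sum_congr rfl fun α _ => ?_
  have hm : (∏ i, MvPolynomial.monomial (Finsupp.single i 1) (h i) ^ α i :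
      MvPolynomial (Fin d) ℝ) =
      MvPolynomial.monomial (Finsupp.equivFunOnFinite.symm α) (∏ i, h i ^ α i) := by
    simp_rw [MvPolynomial.monomial_pow]
    rw [← MvPolynomial.monomial_sum_prod]
    congr 2
    ext i
    simp [Finsupp.finsetSum_apply, Finsupp.single_apply]
  rw [hm, ← nsmul_eq_mul, map_nsmul, symbolOp_monomial]
  simp [mul_assoc]

lemma iteratedDeriv_comp_line (hψ : ContDiff ℝ (⊤ : ℕ∞) ψ) (w h : EuclideanSpace ℝ (Fin d))
    (n : ℕ) (t : ℝ) :
    iteratedDeriv n (fun t : ℝ => ψ (w + t • h)) t =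
      ∑ α ∈ Finset.univ.piAntidiag n,
        (Nat.multinomial Finset.univ α : ℝ) * (∏ i, h i ^ α i) * mderiv α ψ (w + t • h) := by
  rw [← symbolOp_pow]
  induction n generalizing t with
  | zero =>
    rw [pow_zero, iteratedDeriv_zero, ← MvPolynomial.C_1, MvPolynomial.C_apply, symbolOp_monomial]
    simp [mderiv_zero]
  | succ n ih =>
    rw [iteratedDeriv_succ, funext ih, (hasDerivAt_symbolOp hψ w h _ t).deriv, pow_succ']

end PartialDerivatives

section Bounds

variable {d : ℕ} {ψ : EuclideanSpace ℝ (Fin d) → ℝ}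

lemma SlowGrowth.exists_mderiv_bound (hψ : SlowGrowth ψ) {c : ℝ} (hc : 0 < c) (α : Fin d → ℕ) :
    ∃ M : ℝ, 0 ≤ M ∧ ∀ x, |mderiv α ψ x| ≤ M * exp (c * ‖x‖) := by
  have hev := (hψ.2 c hc α).eventually (Metric.closedBall_mem_nhds 0 one_pos)
  obtain ⟨t, ht, hts⟩ := mem_cocompact.1 hev
  have hcont : Continuous fun x => exp (-c * ‖x‖) * mderiv α ψ x :=
    (by fun_prop : Continuous fun x : EuclideanSpace ℝ (Fin d) => exp (-c * ‖x‖)).mul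
      (contDiff_mderiv hψ.1 α).continuous
  obtain ⟨C, hC⟩ := ht.exists_bound_of_continuousOn hcont.continuousOn
  refine ⟨max 1 C, by positivity, fun x => ?_⟩
  have hx : |exp (-c * ‖x‖) * mderiv α ψ x| ≤ max 1 C := by
    by_cases hxt : x ∈ t
    · exact (hC x hxt).trans (le_max_right _ _)
    · have h1 := hts hxt
      rw [Set.mem_ofPred_eq, dist_zero_right] at h1
      exact h1.trans (le_max_left _ _)
  rw [abs_mul, abs_of_pos (exp_pos _)] at hx
  calc |mderiv α ψ x| = exp (-c * ‖x‖) * |mderiv α ψ x| * exp (c * ‖x‖) := by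
        rw [mul_right_comm, ← exp_add]; simp
    _ ≤ _ := by gcongr

lemma abs_prod_pow_le (h : EuclideanSpace ℝ (Fin d)) (α : Fin d → ℕ) :
    |∏ i, h i ^ α i| ≤ ‖h‖ ^ ∑ i, α i := by
  rw [Finset.abs_prod, ← Finset.prod_pow_eq_pow_sum]
  refine Finset.prod_le_prod (fun _ _ => abs_nonneg _) fun i _ => ?_
  rw [abs_pow]
  exact pow_le_pow_left₀ (abs_nonneg _) (PiLp.norm_apply_le h i) _

lemma sum_multiindicesLe (N : ℕ) (F : (Fin d → ℕ) → ℝ) :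
    ∑ α ∈ multiindicesLe d N, F α =
      ∑ k ∈ Finset.range (N + 1), ∑ α ∈ Finset.univ.piAntidiag k, F α := by
  rw [← Finset.sum_fiberwise_of_maps_to (s := multiindicesLe d N) (t := Finset.range (N + 1))
    (g := fun α => ∑ i, α i)]
  · refine Finset.sum_congr rfl fun k hk => Finset.sum_congr ?_ fun _ _ => rfl
    ext α
    simp only [multiindicesLe, Finset.mem_filter, Finset.mem_Iic, Finset.mem_piAntidiag,
      Finset.mem_univ, implies_true, and_true]
    rw [Finset.mem_range] at hk
    refine ⟨fun h => h.2, fun h => ⟨⟨fun i => ?_, h.trans_le (Nat.lt_succ_iff.1 hk)⟩, h⟩⟩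
    replace h : ∑ i, α i = k := h
    have := Finset.single_le_sum (f := α) (fun _ _ => Nat.zero_le _) (Finset.mem_univ i)
    change α i ≤ N
    omega
  · intro α hα
    simp only [multiindicesLe, Finset.mem_filter] at hα
    simp only [Finset.mem_range]
    omega

lemma SlowGrowth.exists_taylor_bound (hψ : SlowGrowth ψ) {c : ℝ} (hc : 0 < c) (N : ℕ) :
    ∃ B : ℝ, 0 ≤ B ∧ ∀ w h : EuclideanSpace ℝ (Fin d),
      |ψ (w + h) - ∑ α ∈ multiindicesLe d N,
        (∏ i, h i ^ α i) / (∏ i, (Nat.factorial (α i) : ℝ)) * mderiv α ψ w| ≤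
        B * ‖h‖ ^ (N + 1) * exp (c * (‖w‖ + ‖h‖)) := by
  choose M hM0 hM using hψ.exists_mderiv_bound hc
  set B : ℝ := ∑ α ∈ Finset.univ.piAntidiag (N + 1),
    (Nat.multinomial Finset.univ α : ℝ) * M α with hB
  have hB0 : 0 ≤ B := Finset.sum_nonneg fun α _ => mul_nonneg (Nat.cast_nonneg _) (hM0 α)
  refine ⟨B, hB0, fun w h => ?_⟩
  have hg : ContDiff ℝ (⊤ : ℕ∞) (fun t : ℝ => ψ (w + t • h)) :=
    hψ.1.comp (contDiff_const.add (contDiff_id.smul contDiff_const))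
  have hwithin (n : ℕ) {t : ℝ} (ht : t ∈ Set.Icc (0 : ℝ) 1) :
      iteratedDerivWithin n (fun t : ℝ => ψ (w + t • h)) (Set.Icc 0 1) t =
        ∑ α ∈ Finset.univ.piAntidiag n,
          (Nat.multinomial Finset.univ α : ℝ) * (∏ i, h i ^ α i) * mderiv α ψ (w + t • h) := by
    rw [iteratedDerivWithin_eq_iteratedDeriv (uniqueDiffOn_Icc one_pos)
      (hg.of_le (by exact_mod_cast le_top)).contDiffAt ht, iteratedDeriv_comp_line hψ.1]
  have hrem (t : ℝ) (ht : t ∈ Set.Icc (0 : ℝ) 1) :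
      ‖iteratedDerivWithin (N + 1) (fun t : ℝ => ψ (w + t • h)) (Set.Icc 0 1) t‖ ≤
        B * ‖h‖ ^ (N + 1) * exp (c * (‖w‖ + ‖h‖)) := by
    rw [hwithin _ ht, hB, Finset.sum_mul, Finset.sum_mul]
    refine (norm_sum_le _ _).trans (Finset.sum_le_sum fun α hα => ?_)
    have hsum : ∑ i, α i = N + 1 := (Finset.mem_piAntidiag.1 hα).1
    have hprod := abs_prod_pow_le h α
    rw [hsum] at hprod
    have hnorm : ‖w + t • h‖ ≤ ‖w‖ + ‖h‖ := by
      refine (norm_add_le _ _).trans ?_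
      rw [norm_smul, Real.norm_of_nonneg ht.1]
      gcongr
      exact mul_le_of_le_one_left (norm_nonneg _) ht.2
    rw [Real.norm_eq_abs, abs_mul, abs_mul, Nat.abs_cast]
    calc (Nat.multinomial Finset.univ α : ℝ) * |∏ i, h i ^ α i| * |mderiv α ψ (w + t • h)|
        ≤ (Nat.multinomial Finset.univ α : ℝ) * ‖h‖ ^ (N + 1) *
            (M α * exp (c * (‖w‖ + ‖h‖))) := by
          gcongr
          exact (hM α _).trans (by have := hM0 α; gcongr)
      _ = _ := by ring
  have hT := taylor_mean_remainder_bound (n := N) (zero_le_one' ℝ)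
    (hg.of_le (by exact_mod_cast le_top)).contDiffOn (Set.right_mem_Icc.2 zero_le_one) hrem
  rw [taylor_within_apply] at hT
  have hpoly : ∑ k ∈ Finset.range (N + 1), ((Nat.factorial k : ℝ)⁻¹ * (1 - 0) ^ k) •
      iteratedDerivWithin k (fun t : ℝ => ψ (w + t • h)) (Set.Icc 0 1) 0 =
      ∑ α ∈ multiindicesLe d N,
        (∏ i, h i ^ α i) / (∏ i, (Nat.factorial (α i) : ℝ)) * mderiv α ψ w := by
    rw [sum_multiindicesLe]
    refine Finset.sum_congr rfl fun k _ => ?_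
    rw [hwithin _ (Set.left_mem_Icc.2 zero_le_one), Finset.smul_sum]
    refine Finset.sum_congr rfl fun α hα => ?_
    have hsum : ∑ i, α i = k := (Finset.mem_piAntidiag.1 hα).1
    have hmul := Nat.multinomial_spec Finset.univ α
    rw [hsum] at hmul
    have hmul' : (∏ i, (Nat.factorial (α i) : ℝ)) * (Nat.multinomial Finset.univ α : ℝ) =
        (Nat.factorial k : ℝ) := by exact_mod_cast hmul
    have h1 : (∏ i, (Nat.factorial (α i) : ℝ)) ≠ 0 :=
      Finset.prod_ne_zero_iff.2 fun i _ => Nat.cast_ne_zero.2 (Nat.factorial_ne_zero _)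
    have h2 : (Nat.multinomial Finset.univ α : ℝ) ≠ 0 := by
      intro h0
      rw [h0, mul_zero] at hmul'
      exact Nat.cast_ne_zero.2 (Nat.factorial_ne_zero k) hmul'.symm
    rw [← hmul']
    simp only [zero_smul, add_zero, sub_zero, one_pow, mul_one, smul_eq_mul]
    field_simp
  rw [hpoly] at hT
  simp only [one_smul, Real.norm_eq_abs, sub_zero, one_pow, mul_one] at hT
  refine hT.trans (div_le_self (by positivity) ?_)
  exact_mod_cast Nat.one_le_iff_ne_zero.2 (Nat.factorial_ne_zero N)

lemma pow_le_factorial_div_mul_exp {c r : ℝ} (hc : 0 < c) (hr : 0 ≤ r) (n : ℕ) :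
    r ^ n ≤ (Nat.factorial n : ℝ) / c ^ n * exp (c * r) := by
  have h := Real.pow_div_factorial_le_exp (c * r) (by positivity) n
  have hn : (0 : ℝ) < Nat.factorial n := by exact_mod_cast Nat.factorial_pos n
  rw [div_le_iff₀ hn, mul_pow] at h
  rw [div_mul_eq_mul_div, le_div_iff₀ (by positivity)]
  linarith

lemma integrable_exp_neg_mul_norm {c : ℝ} (hc : 0 < c) :
    Integrable fun x : EuclideanSpace ℝ (Fin d) => exp (-c * ‖x‖) := by
  have h := integrable_one_add_norm (E := EuclideanSpace ℝ (Fin d)) (μ := volume)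
    (r := ((d + 1 : ℕ) : ℝ)) (by simp)
  refine (h.const_mul ((Nat.factorial (d + 1) : ℝ) / c ^ (d + 1) * exp c)).mono'
    (by fun_prop) (ae_of_all _ fun x => ?_)
  have hp := pow_le_factorial_div_mul_exp hc (by positivity : 0 ≤ 1 + ‖x‖) (d + 1)
  have hx : (0 : ℝ) < (1 + ‖x‖) ^ (d + 1) := by positivity
  rw [Real.norm_of_nonneg (exp_pos _).le, rpow_neg (by positivity), rpow_natCast,
    ← div_eq_mul_inv, le_div_iff₀ hx]
  calc exp (-c * ‖x‖) * (1 + ‖x‖) ^ (d + 1)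
      ≤ exp (-c * ‖x‖) * ((Nat.factorial (d + 1) : ℝ) / c ^ (d + 1) * exp (c * (1 + ‖x‖))) := by
        gcongr
    _ = (Nat.factorial (d + 1) : ℝ) / c ^ (d + 1) * (exp (-c * ‖x‖) * exp (c * (1 + ‖x‖))) := by
        ring
    _ = _ := by rw [← exp_add]; ring_nf

lemma ExpOrder.exists_integral_mul_bound {f : EuclideanSpace ℝ (Fin d) → ℝ} (hf : ExpOrder f) :
    ∃ c J : ℝ, 0 < c ∧ 0 ≤ J ∧ ∀ (g : EuclideanSpace ℝ (Fin d) → ℝ) (A : ℝ), Continuous g →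
      (∀ y, |g y| ≤ A * exp (2 * c * ‖y‖)) →
        Integrable (fun y => f y * g y) ∧ |∫ y, f y * g y| ≤ J * A := by
  obtain ⟨hfi, C, γ, hC, hγ, hbd⟩ := hf
  have hI := integrable_exp_neg_mul_norm (d := d) (half_pos hγ)
  refine ⟨γ / 4, C * ∫ x : EuclideanSpace ℝ (Fin d), exp (-(γ / 2) * ‖x‖), by positivity,
    mul_nonneg hC.le (integral_nonneg fun _ => (exp_pos _).le), fun g A hg hgA => ?_⟩
  have hle : ∀ᵐ y, ‖f y * g y‖ ≤ C * A * exp (-(γ / 2) * ‖y‖) := by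
    filter_upwards [hbd] with y hy
    rw [norm_mul]
    calc ‖f y‖ * ‖g y‖ ≤ (C * exp (-γ * ‖y‖)) * (A * exp (2 * (γ / 4) * ‖y‖)) :=
          mul_le_mul hy (hgA y) (norm_nonneg _) (by positivity)
      _ = C * A * (exp (-γ * ‖y‖) * exp (2 * (γ / 4) * ‖y‖)) := by ring
      _ = _ := by rw [← exp_add]; ring_nf
  have hJ := hI.const_mul (C * A)
  refine ⟨hJ.mono' (hfi.aestronglyMeasurable.mul hg.aestronglyMeasurable) hle, ?_⟩
  refine (norm_integral_le_of_norm_le hJ hle).trans_eq ?_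
  rw [integral_const_mul]
  ring

end Bounds

/-- **Locally uniform asymptotic moment expansion of convolutions** (Theorem 4): for `f`
integrable of exponential order and `ψ` smooth of slower-than-exponential growth, the
moment expansion of `(f * ψ_σ)(σw)` to order `N` has error `o(σ^{-N-d})`, locally
uniformly in `w`. -/
theorem moment_expansion_locally_uniform {d : ℕ}
    (f : EuclideanSpace ℝ (Fin d) → ℝ) (hf : ExpOrder f)
    (ψ : EuclideanSpace ℝ (Fin d) → ℝ) (hψ : SlowGrowth ψ)
    (N : ℕ) (K : Set (EuclideanSpace ℝ (Fin d))) (hK : IsCompact K) :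
    ∀ ε > (0 : ℝ), ∀ᶠ σ : ℝ in atTop, ∀ w ∈ K,
      |σ ^ (N + d) * (convScaled f ψ σ (σ • w) -
        ∑ α ∈ multiindicesLe d N,
          ((-1 : ℝ) ^ (∑ i, α i) / ∏ i, (Nat.factorial (α i) : ℝ)) * momentD f α *
            σ ^ (-((∑ i, α i : ℕ) : ℤ) - (d : ℤ)) * mderiv α ψ w)| < ε := by
  intro ε hε
  obtain ⟨c, J, hc, hJ, hbound⟩ := hf.exists_integral_mul_bound
  obtain ⟨B, hB, hTaylor⟩ := hψ.exists_taylor_bound hc N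
  obtain ⟨R, hR⟩ := hK.isBounded.exists_norm_le
  obtain ⟨M, hM0, hM⟩ := hψ.exists_mderiv_bound hc 0
  rw [mderiv_zero] at hM
  set A : ℝ := B * exp (c * R) * ((Nat.factorial (N + 1) : ℝ) / c ^ (N + 1)) with hA
  filter_upwards [eventually_ge_atTop 1, eventually_gt_atTop (J * A / ε)] with σ hσ1 hσ w hw
  have hσ0 : 0 < σ := one_pos.trans_le hσ1
  have hinv1 : σ⁻¹ ≤ 1 := inv_le_one_of_one_le₀ hσ1
  have hexp (y : EuclideanSpace ℝ (Fin d)) : exp (c * ‖y‖) ≤ exp (2 * c * ‖y‖) :=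
    exp_le_exp.2 (by nlinarith [norm_nonneg y])
  have hnorm (y : EuclideanSpace ℝ (Fin d)) : ‖-(σ⁻¹ • y)‖ = σ⁻¹ * ‖y‖ := by
    rw [norm_neg, norm_smul, Real.norm_of_nonneg (by positivity)]
  have hnorm_le (y : EuclideanSpace ℝ (Fin d)) : σ⁻¹ * ‖y‖ ≤ ‖y‖ :=
    mul_le_of_le_one_left (norm_nonneg y) hinv1
  have hψint : Integrable fun y => f y * ψ (w + -(σ⁻¹ • y)) := by
    refine (hbound _ (M * exp (c * ‖w‖)) (hψ.1.continuous.comp (by fun_prop)) fun y => ?_).1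
    calc |ψ (w + -(σ⁻¹ • y))| ≤ M * exp (c * ‖w + -(σ⁻¹ • y)‖) := hM _
      _ ≤ M * exp (c * (‖w‖ + ‖y‖)) := by
        gcongr
        exact (norm_add_le _ _).trans (by rw [hnorm]; linarith [hnorm_le y])
      _ = M * exp (c * ‖w‖) * exp (c * ‖y‖) := by rw [mul_add, exp_add]; ring
      _ ≤ _ := mul_le_mul_of_nonneg_left (hexp y) (by positivity)
  have hmoment (α : Fin d → ℕ) : Integrable fun y => f y * ∏ i, y i ^ α i := by
    refine (hbound _ ((Nat.factorial (∑ i, α i) : ℝ) / c ^ (∑ i, α i)) (by fun_prop)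
      fun y => ?_).1
    refine (abs_prod_pow_le y α).trans
      ((pow_le_factorial_div_mul_exp hc (norm_nonneg y) _).trans ?_)
    exact mul_le_mul_of_nonneg_left (hexp y) (by positivity)
  set coeff : (Fin d → ℕ) → ℝ := fun α =>
    (-1 : ℝ) ^ (∑ i, α i) * (σ⁻¹) ^ (∑ i, α i) / (∏ i, (Nat.factorial (α i) : ℝ)) * mderiv α ψ w
    with hcoeff
  have hterm (α : Fin d → ℕ) (y : EuclideanSpace ℝ (Fin d)) :
      (∏ i, (-(σ⁻¹ • y)) i ^ α i) / (∏ i, (Nat.factorial (α i) : ℝ)) * mderiv α ψ w =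
        coeff α * ∏ i, y i ^ α i := by
    have h1 : ∏ i, (-(σ⁻¹ • y)) i ^ α i =
        (-1 : ℝ) ^ (∑ i, α i) * (σ⁻¹) ^ (∑ i, α i) * ∏ i, y i ^ α i := by
      rw [← mul_pow, ← Finset.prod_pow_eq_pow_sum, ← Finset.prod_mul_distrib]
      refine Finset.prod_congr rfl fun i _ => ?_
      rw [← mul_pow]
      simp
    rw [h1, hcoeff]
    ring
  set rem : EuclideanSpace ℝ (Fin d) → ℝ := fun y =>
    ψ (w + -(σ⁻¹ • y)) - ∑ α ∈ multiindicesLe d N, coeff α * ∏ i, y i ^ α i with hrem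
  have hremcont : Continuous rem :=
    (hψ.1.continuous.comp (by fun_prop : Continuous fun y : EuclideanSpace ℝ (Fin d) =>
      w + -(σ⁻¹ • y))).sub (by fun_prop)
  have hrembound (y : EuclideanSpace ℝ (Fin d)) :
      |rem y| ≤ A * (σ⁻¹) ^ (N + 1) * exp (2 * c * ‖y‖) := by
    have h1 := hTaylor w (-(σ⁻¹ • y))
    simp only [hterm, hnorm] at h1
    calc |rem y| ≤ B * (σ⁻¹ * ‖y‖) ^ (N + 1) * exp (c * (‖w‖ + σ⁻¹ * ‖y‖)) := h1
      _ ≤ B * (σ⁻¹ * ‖y‖) ^ (N + 1) * exp (c * (R + ‖y‖)) := by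
        gcongr
        · exact hR w hw
        · exact hnorm_le y
      _ = B * (σ⁻¹) ^ (N + 1) * exp (c * (R + ‖y‖)) * ‖y‖ ^ (N + 1) := by ring
      _ ≤ B * (σ⁻¹) ^ (N + 1) * exp (c * (R + ‖y‖)) *
          ((Nat.factorial (N + 1) : ℝ) / c ^ (N + 1) * exp (c * ‖y‖)) := by
        gcongr
        exact pow_le_factorial_div_mul_exp hc (norm_nonneg y) _
      _ = B * ((Nat.factorial (N + 1) : ℝ) / c ^ (N + 1)) * (σ⁻¹) ^ (N + 1) *
          (exp (c * (R + ‖y‖)) * exp (c * ‖y‖)) := by ring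
      _ = B * ((Nat.factorial (N + 1) : ℝ) / c ^ (N + 1)) * (σ⁻¹) ^ (N + 1) *
          (exp (c * R) * exp (2 * c * ‖y‖)) := by
        rw [← exp_add, ← exp_add]; ring_nf
      _ = _ := by rw [hA]; ring
  have hint : ∫ y, f y * rem y = (∫ y, f y * ψ (w + -(σ⁻¹ • y))) -
      ∑ α ∈ multiindicesLe d N, coeff α * momentD f α := by
    have hsplit (y : EuclideanSpace ℝ (Fin d)) : f y * rem y = f y * ψ (w + -(σ⁻¹ • y)) -
        ∑ α ∈ multiindicesLe d N, coeff α * (f y * ∏ i, y i ^ α i) := by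
      simp only [hrem, mul_sub, Finset.mul_sum]
      congr 1
      exact Finset.sum_congr rfl fun α _ => by ring
    simp only [hsplit]
    rw [integral_sub hψint (integrable_finsetSum _ fun α _ => (hmoment α).const_mul _),
      integral_finsetSum _ fun α _ => (hmoment α).const_mul _]
    simp only [integral_const_mul, momentD, mul_comm (f _)]
  have hconv : convScaled f ψ σ (σ • w) = (σ ^ d)⁻¹ * ∫ y, f y * ψ (w + -(σ⁻¹ • y)) := by
    rw [convScaled, ← integral_const_mul]
    congr 1
    funext y
    rw [smul_sub, inv_smul_smul₀ hσ0.ne', sub_eq_add_neg]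
    ring
  have hmain : σ ^ (N + d) * (convScaled f ψ σ (σ • w) -
        ∑ α ∈ multiindicesLe d N,
          ((-1 : ℝ) ^ (∑ i, α i) / ∏ i, (Nat.factorial (α i) : ℝ)) * momentD f α *
            σ ^ (-((∑ i, α i : ℕ) : ℤ) - (d : ℤ)) * mderiv α ψ w) =
      σ ^ N * ∫ y, f y * rem y := by
    have hsum : ∑ α ∈ multiindicesLe d N,
          ((-1 : ℝ) ^ (∑ i, α i) / ∏ i, (Nat.factorial (α i) : ℝ)) * momentD f α *
            σ ^ (-((∑ i, α i : ℕ) : ℤ) - (d : ℤ)) * mderiv α ψ w =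
        (σ ^ d)⁻¹ * ∑ α ∈ multiindicesLe d N, coeff α * momentD f α := by
      rw [Finset.mul_sum]
      refine Finset.sum_congr rfl fun α _ => ?_
      rw [zpow_sub₀ hσ0.ne', zpow_neg, zpow_natCast, zpow_natCast, ← inv_pow σ (∑ i, α i)]
      ring
    rw [hconv, hsum, ← mul_sub, ← hint, pow_add, mul_assoc, mul_inv_cancel_left₀ (by positivity)]
  have hfinal := (hbound rem _ hremcont hrembound).2
  rw [hmain, abs_mul, abs_of_pos (by positivity)]
  calc σ ^ N * |∫ y, f y * rem y| ≤ σ ^ N * (J * (A * (σ⁻¹) ^ (N + 1))) := by gcongr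
    _ = J * A / σ := by rw [inv_pow, pow_succ]; field_simp
    _ < ε := by
      rw [div_lt_iff₀ hσ0]
      rw [div_lt_iff₀ hε] at hσ
      linarith
end
end

section
/- (Asymptotic moment expansion with finitely many moments) Let N ≥ 1 be an integer, let ψ : ℝ → ℝ belong to the class 𝓜_N, and let f : ℝ → ℝ be measurable with ∫(1+|x|)^N |f(x)| dx < ∞; set μ_n = ∫ x^n f(x) dx for 0 ≤ n ≤ N. Then for every integer M with 0 ≤ M ≤ N−1 and every compact set K ⊆ ℝ, sup_{w∈K} | σ^{M+1} ( (f*ψ_σ)(σw) − Σ_{n=0}^{M} ((−1)^n/n!) μ_n σ^{−n−1} ψ^{(n)}(w) ) | → 0 as σ → ∞. -/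
open MeasureTheory Real Filter Topology

noncomputable section

/-- `ψ` belongs to the class `𝓜_N`: it is smooth and for every `n ≥ 0` the seminorm
`‖ψ‖_{N,n} = sup_x (1+|x|)^{-(N-n)} |ψ^{(n)}(x)|` is finite. -/
def MClass (N : ℕ) (ψ : ℝ → ℝ) : Prop :=
  ContDiff ℝ (⊤ : ℕ∞) ψ ∧ ∀ n : ℕ, ∃ C : ℝ,
    ∀ x : ℝ, (1 + |x|) ^ ((n : ℤ) - (N : ℤ)) * |iteratedDeriv n ψ x| ≤ C

/-- The `n`-th moment `μ_n = ∫ x^n f(x) dx`. -/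
def moment1 (f : ℝ → ℝ) (n : ℕ) : ℝ := ∫ x : ℝ, x ^ n * f x

lemma MClass.exists_abs_iteratedDeriv_le {N n : ℕ} {ψ : ℝ → ℝ} (hψ : MClass N ψ) (hn : n ≤ N) :
    ∃ C : ℝ, 0 ≤ C ∧ ∀ x : ℝ, |iteratedDeriv n ψ x| ≤ C * (1 + |x|) ^ (N - n) := by
  obtain ⟨C, hC⟩ := hψ.2 n
  refine ⟨C, le_trans (by positivity) (hC 0), fun x => ?_⟩
  have hx : (0 : ℝ) < 1 + |x| := by positivity
  have hpow : (1 + |x|) ^ ((n : ℤ) - (N : ℤ)) = ((1 + |x|) ^ (N - n))⁻¹ := by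
    rw [← zpow_natCast, ← zpow_neg]
    congr 1
    omega
  have h := hC x
  rw [hpow, inv_mul_le_iff₀ (by positivity)] at h
  linarith

/-- Lagrange form of the Taylor remainder, with the base point and increment on either side. -/
lemma exists_taylor_remainder_eq {ψ : ℝ → ℝ} (hψ : ContDiff ℝ (⊤ : ℕ∞) ψ) (M : ℕ) (w h : ℝ) :
    ∃ ξ : ℝ, |ξ| ≤ |w| + |h| ∧
      ψ (w - h) - ∑ n ∈ Finset.range (M + 1),
          (-1 : ℝ) ^ n / (Nat.factorial n : ℝ) * h ^ n * iteratedDeriv n ψ w =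
        iteratedDeriv (M + 1) ψ ξ * (-h) ^ (M + 1) / (Nat.factorial (M + 1) : ℝ) := by
  rcases eq_or_ne h 0 with rfl | hh
  · refine ⟨w, by simp, ?_⟩
    rw [Finset.sum_range_succ']
    simp
  have hne : w ≠ w - h := fun H => hh (by linarith)
  have hcd (n : ℕ) : ContDiff ℝ n ψ := hψ.of_le (by exact_mod_cast le_top)
  obtain ⟨ξ, hξ, heq⟩ := taylor_mean_remainder_lagrange_iteratedDeriv (n := M) hne
    (by exact_mod_cast (hcd (M + 1)).contDiffOn)
  refine ⟨ξ, ?_, ?_⟩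
  · have h1 := Set.abs_sub_left_of_mem_uIcc (Set.uIoo_subset_uIcc_self hξ)
    have h2 : |ξ| ≤ |w| + |ξ - w| := by
      simpa using abs_add_le w (ξ - w)
    have h3 : |w - h - w| = |h| := by rw [sub_right_comm, sub_self, zero_sub, abs_neg]
    linarith
  · rw [taylor_within_apply, sub_sub_cancel_left] at heq
    rw [← heq]
    congr 1
    refine Finset.sum_congr rfl fun n _ => ?_
    rw [iteratedDerivWithin_eq_iteratedDeriv (uniqueDiffOn_uIcc hne) (hcd n).contDiffAt
      Set.left_mem_uIcc, smul_eq_mul, neg_pow h]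
    ring

lemma abs_taylor_remainder_le {N M : ℕ} {ψ : ℝ → ℝ} {C R : ℝ}
    (hψ : ContDiff ℝ (⊤ : ℕ∞) ψ) (hMN : M + 1 ≤ N) (hC : 0 ≤ C)
    (hbound : ∀ x : ℝ, |iteratedDeriv (M + 1) ψ x| ≤ C * (1 + |x|) ^ (N - (M + 1)))
    {w : ℝ} (hw : |w| ≤ R) {σ : ℝ} (hσ : 1 ≤ σ) (y : ℝ) :
    |ψ (w - y / σ) - ∑ n ∈ Finset.range (M + 1),
        (-1 : ℝ) ^ n / (Nat.factorial n : ℝ) * (y / σ) ^ n * iteratedDeriv n ψ w| ≤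
      C * (1 + R) ^ (N - (M + 1)) * (σ ^ (M + 1))⁻¹ * (1 + |y|) ^ N := by
  have hσ0 : 0 < σ := by linarith
  have hR : 0 ≤ R := (abs_nonneg w).trans hw
  obtain ⟨ξ, hξ, heq⟩ := exists_taylor_remainder_eq hψ M w (y / σ)
  rw [heq, abs_div, abs_mul, abs_pow, abs_neg, abs_div, abs_of_pos hσ0, Nat.abs_cast]
  have hyσ : |y / σ| ≤ |y| := by
    rw [abs_div, abs_of_pos hσ0]
    exact div_le_self (abs_nonneg y) hσ
  have hξ' : 1 + |ξ| ≤ (1 + R) * (1 + |y|) := by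
    nlinarith [mul_nonneg hR (abs_nonneg y)]
  calc |iteratedDeriv (M + 1) ψ ξ| * (|y| / σ) ^ (M + 1) / (Nat.factorial (M + 1) : ℝ)
      ≤ |iteratedDeriv (M + 1) ψ ξ| * (|y| / σ) ^ (M + 1) :=
        div_le_self (by positivity) (by exact_mod_cast Nat.succ_le_of_lt (Nat.factorial_pos _))
    _ ≤ (C * ((1 + R) * (1 + |y|)) ^ (N - (M + 1))) * ((1 + |y|) / σ) ^ (M + 1) := by
        have h1 : |y| ≤ 1 + |y| := by linarith
        have h2 := hbound ξ
        gcongr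
        exact h2.trans (by gcongr)
    _ = C * (1 + R) ^ (N - (M + 1)) * (σ ^ (M + 1))⁻¹ *
          ((1 + |y|) ^ (N - (M + 1)) * (1 + |y|) ^ (M + 1)) := by
        rw [mul_pow, div_pow]
        ring
    _ = _ := by rw [← pow_add, Nat.sub_add_cancel hMN]

lemma integrable_pow_mul_of_le {N n : ℕ} (hn : n ≤ N) {f : ℝ → ℝ} (hmeas : Measurable f)
    (hint : Integrable (fun x : ℝ => (1 + |x|) ^ N * |f x|)) :
    Integrable (fun x : ℝ => x ^ n * f x) := by
  refine hint.mono' (by fun_prop) (Eventually.of_forall fun x => ?_)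
  rw [norm_mul, norm_pow, Real.norm_eq_abs, Real.norm_eq_abs]
  gcongr
  calc |x| ^ n ≤ (1 + |x|) ^ n := by gcongr; linarith
    _ ≤ (1 + |x|) ^ N := pow_le_pow_right₀ (by linarith [abs_nonneg x]) hn

/-- The error of the moment expansion is the integral of `f` against the Taylor remainder. -/
lemma convScaled1_sub_sum_eq {N M : ℕ} {ψ f : ℝ → ℝ} (hMN : M ≤ N) (hmeas : Measurable f)
    (hint : Integrable (fun x : ℝ => (1 + |x|) ^ N * |f x|)) {σ : ℝ} (hσ : 0 < σ) (w : ℝ)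
    (hrem : Integrable fun y : ℝ => f y * (ψ (w - y / σ) - ∑ n ∈ Finset.range (M + 1),
        (-1 : ℝ) ^ n / (Nat.factorial n : ℝ) * (y / σ) ^ n * iteratedDeriv n ψ w)) :
    convScaled1 f ψ σ (σ * w) - ∑ n ∈ Finset.range (M + 1),
        ((-1 : ℝ) ^ n / (Nat.factorial n : ℝ)) * moment1 f n *
          σ ^ (-(n : ℤ) - 1) * iteratedDeriv n ψ w =
      σ⁻¹ * ∫ y, f y * (ψ (w - y / σ) - ∑ n ∈ Finset.range (M + 1),
        (-1 : ℝ) ^ n / (Nat.factorial n : ℝ) * (y / σ) ^ n * iteratedDeriv n ψ w) := by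
  set c : ℕ → ℝ := fun n => (-1 : ℝ) ^ n / (Nat.factorial n : ℝ) *
    σ ^ (-(n : ℤ) - 1) * iteratedDeriv n ψ w with hc
  have hterm : ∀ n ∈ Finset.range (M + 1), Integrable fun y : ℝ => c n * (y ^ n * f y) :=
    fun n hn => (integrable_pow_mul_of_le
      ((Nat.lt_succ_iff.mp (Finset.mem_range.mp hn)).trans hMN) hmeas hint).const_mul _
  have hpt (y : ℝ) : f y * (σ⁻¹ * ψ ((σ * w - y) / σ)) =
      σ⁻¹ * (f y * (ψ (w - y / σ) - ∑ n ∈ Finset.range (M + 1),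
        (-1 : ℝ) ^ n / (Nat.factorial n : ℝ) * (y / σ) ^ n * iteratedDeriv n ψ w)) +
      ∑ n ∈ Finset.range (M + 1), c n * (y ^ n * f y) := by
    have hsum : ∑ n ∈ Finset.range (M + 1), c n * (y ^ n * f y) =
        σ⁻¹ * (f y * ∑ n ∈ Finset.range (M + 1),
          (-1 : ℝ) ^ n / (Nat.factorial n : ℝ) * (y / σ) ^ n * iteratedDeriv n ψ w) := by
      rw [Finset.mul_sum, Finset.mul_sum]
      refine Finset.sum_congr rfl fun n _ => ?_
      rw [hc]
      simp only
      rw [zpow_sub₀ hσ.ne', zpow_neg, zpow_natCast, zpow_one, div_pow]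
      ring
    rw [hsum, sub_div, mul_div_cancel_left₀ _ hσ.ne']
    ring
  have hconv : convScaled1 f ψ σ (σ * w) = _ := integral_congr_ae (Eventually.of_forall hpt)
  rw [hconv, integral_add (hrem.const_mul _) (integrable_finsetSum _ hterm),
    integral_finsetSum _ hterm, integral_const_mul, add_sub_assoc, add_eq_left, sub_eq_zero]
  refine Finset.sum_congr rfl fun n _ => ?_
  rw [integral_const_mul, hc, moment1]
  ring

/-- **Asymptotic moment expansion with finitely many moments** (Theorem 5): for
`ψ ∈ 𝓜_N` and `f` with finite moments through order `N`, the moment expansion of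
`(f * ψ_σ)(σw)` to any order `M ≤ N - 1` has error `o(σ^{-M-1})`, locally uniformly
in `w`. -/
theorem finite_moment_expansion (N : ℕ) (hN : 1 ≤ N) (ψ : ℝ → ℝ) (hψ : MClass N ψ)
    (f : ℝ → ℝ) (hmeas : Measurable f)
    (hint : Integrable (fun x : ℝ => (1 + |x|) ^ N * |f x|))
    (M : ℕ) (hM : M ≤ N - 1) (K : Set ℝ) (hK : IsCompact K) :
    ∀ ε > (0 : ℝ), ∀ᶠ σ : ℝ in atTop, ∀ w ∈ K,
      |σ ^ (M + 1) * (convScaled1 f ψ σ (σ * w) -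
        ∑ n ∈ Finset.range (M + 1),
          ((-1 : ℝ) ^ n / (Nat.factorial n : ℝ)) * moment1 f n *
            σ ^ (-(n : ℤ) - 1) * iteratedDeriv n ψ w)| < ε := by
  have hMN : M + 1 ≤ N := by omega
  obtain ⟨C, hC, hbound⟩ := hψ.exists_abs_iteratedDeriv_le hMN
  obtain ⟨R, hR⟩ := hK.isBounded.exists_norm_le
  set D : ℝ := C * (1 + R) ^ (N - (M + 1)) with hD
  set I : ℝ := ∫ x : ℝ, (1 + |x|) ^ N * |f x| with hI
  intro ε hε
  have hlim : Tendsto (fun σ : ℝ => σ⁻¹ * (D * I)) atTop (𝓝 0) := by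
    simpa using tendsto_inv_atTop_zero.mul_const (D * I)
  filter_upwards [hlim.eventually_lt_const hε, eventually_ge_atTop 1] with σ hσε hσ w hw
  have hσ0 : 0 < σ := by linarith
  set r : ℝ → ℝ := fun y => f y * (ψ (w - y / σ) - ∑ n ∈ Finset.range (M + 1),
    (-1 : ℝ) ^ n / (Nat.factorial n : ℝ) * (y / σ) ^ n * iteratedDeriv n ψ w) with hr
  have hrle (y : ℝ) : ‖r y‖ ≤ D * (σ ^ (M + 1))⁻¹ * ((1 + |y|) ^ N * |f y|) := by
    rw [hr, norm_mul, Real.norm_eq_abs, Real.norm_eq_abs]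
    have h := mul_le_mul_of_nonneg_left
      (abs_taylor_remainder_le hψ.1 hMN hC hbound (hR w hw) hσ y) (abs_nonneg (f y))
    exact h.trans_eq (by ring)
  have hψc : Continuous ψ := hψ.1.continuous
  have hrint : Integrable r := by
    refine (hint.const_mul (D * (σ ^ (M + 1))⁻¹)).mono' ?_ (Eventually.of_forall hrle)
    exact (hmeas.mul (Continuous.measurable (by fun_prop))).aestronglyMeasurable
  rw [convScaled1_sub_sum_eq (by omega) hmeas hint hσ0 w hrint, abs_mul, abs_mul, abs_pow, abs_inv,
    abs_of_pos hσ0]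
  refine lt_of_le_of_lt ?_ hσε
  have hnorm : |∫ y, r y| ≤ D * (σ ^ (M + 1))⁻¹ * I := by
    rw [hI, ← integral_const_mul]
    exact norm_integral_le_of_norm_le (hint.const_mul _) (Eventually.of_forall hrle)
  calc σ ^ (M + 1) * (σ⁻¹ * |∫ y, r y|)
      ≤ σ ^ (M + 1) * (σ⁻¹ * (D * (σ ^ (M + 1))⁻¹ * I)) := by gcongr
    _ = σ⁻¹ * (D * I) := by field_simp
end
end

section
/- Let ρ : ℝ^d × ℝ^d → ℝ be a smooth function on ℝ^{2d} whose derivatives all have slower-than-exponential growth (for every γ>0 and every multiindex α on ℝ^{2d}, e^{−γ|(w,y)|}∂^α ρ(w,y) → 0 as |(w,y)| → ∞). Suppose that for some integer N ≥ 0 one has ∂_y^α ρ(w,0) = 0 for every w ∈ ℝ^d and every multiindex α with |α| ≤ N. Then for every γ > 0, every multiindex α, and every compact set K ⊆ ℝ^d, sup_{w∈K} σ^N · sup_{y∈ℝ^d} | e^{−γ|y|} ∂_y^α [ y ↦ ρ(w, y/σ) ](y) | → 0 as σ → ∞. -/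
open MeasureTheory Real Filter Topology

noncomputable section

/-- Directional derivative of a function on `ℝ^d × ℝ^d` in the direction `v`. -/
def pdDir {d : ℕ} (v : EuclideanSpace ℝ (Fin d) × EuclideanSpace ℝ (Fin d))
    (ρ : EuclideanSpace ℝ (Fin d) × EuclideanSpace ℝ (Fin d) → ℝ) :
    EuclideanSpace ℝ (Fin d) × EuclideanSpace ℝ (Fin d) → ℝ :=
  fun p => fderiv ℝ ρ p v

/-- Mixed partial derivative `∂_w^α ∂_y^β ρ` of a function `ρ(w,y)` on `ℝ^d × ℝ^d`. -/
def mderivWY {d : ℕ} (α β : Fin d → ℕ)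
    (ρ : EuclideanSpace ℝ (Fin d) × EuclideanSpace ℝ (Fin d) → ℝ) :
    EuclideanSpace ℝ (Fin d) × EuclideanSpace ℝ (Fin d) → ℝ :=
  (List.finRange d).foldr
    (fun i F => (pdDir ((EuclideanSpace.single i 1 : EuclideanSpace ℝ (Fin d)), 0))^[α i] F)
    ((List.finRange d).foldr
      (fun i F => (pdDir ((0 : EuclideanSpace ℝ (Fin d)), EuclideanSpace.single i 1))^[β i] F)
      ρ)

section

variable {d : ℕ}

local notation "E" => EuclideanSpace ℝ (Fin d)

theorem ContDiff.pdDir {f : E × E → ℝ} (hf : ContDiff ℝ (⊤ : ℕ∞) f) (v : E × E) :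
    ContDiff ℝ (⊤ : ℕ∞) (pdDir v f) :=
  (hf.fderiv_right (by simp)).clm_apply contDiff_const

theorem ContDiff.pdDir_iterate {f : E × E → ℝ} (hf : ContDiff ℝ (⊤ : ℕ∞) f) (v : E × E)
    (n : ℕ) : ContDiff ℝ (⊤ : ℕ∞) ((_root_.pdDir v)^[n] f) := by
  induction n with
  | zero => exact hf
  | succ n ih =>
    rw [Function.iterate_succ_apply']
    exact ih.pdDir v

theorem ContDiff.foldr_pdDir {f : E × E → ℝ} (hf : ContDiff ℝ (⊤ : ℕ∞) f)
    (v : Fin d → E × E) (α : Fin d → ℕ) (l : List (Fin d)) :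
    ContDiff ℝ (⊤ : ℕ∞) (l.foldr (fun i F => (_root_.pdDir (v i))^[α i] F) f) := by
  induction l with
  | nil => exact hf
  | cons i l ih => exact ih.pdDir_iterate _ _

theorem pdDir_comm {f : E × E → ℝ} (hf : ContDiff ℝ (⊤ : ℕ∞) f) (u v : E × E) :
    pdDir u (pdDir v f) = pdDir v (pdDir u f) := by
  have hd : Differentiable ℝ (fderiv ℝ f) :=
    (hf.fderiv_right (m := (⊤ : ℕ∞)) (by simp)).differentiable (by simp)
  have key (a b : E × E) (p : E × E) :
      pdDir a (pdDir b f) p = fderiv ℝ (fderiv ℝ f) p a b := by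
    have h := ((hd p).hasFDerivAt.clm_apply (hasFDerivAt_const b p)).fderiv
    change fderiv ℝ (fun q => fderiv ℝ f q b) p a = _
    rw [h]
    simp
  funext p
  rw [key, key]
  exact second_derivative_symmetric (f := f) (f' := fderiv ℝ f)
    (fun y => (hf.differentiable (by simp) y).hasFDerivAt) (hd p).hasFDerivAt u v

theorem pdDir_comm_iterate {f : E × E → ℝ} (hf : ContDiff ℝ (⊤ : ℕ∞) f) (u v : E × E)
    (n : ℕ) : pdDir u ((pdDir v)^[n] f) = (pdDir v)^[n] (pdDir u f) := by
  induction n with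
  | zero => rfl
  | succ n ih =>
    rw [Function.iterate_succ_apply', Function.iterate_succ_apply',
      pdDir_comm (hf.pdDir_iterate v n), ih]

theorem pdDir_foldr {f : E × E → ℝ} (hf : ContDiff ℝ (⊤ : ℕ∞) f) (v : Fin d → E × E)
    (α : Fin d → ℕ) (i : Fin d) {l : List (Fin d)} (hl : l.Nodup) (hi : i ∈ l) :
    pdDir (v i) (l.foldr (fun j F => (pdDir (v j))^[α j] F) f) =
      l.foldr (fun j F => (pdDir (v j))^[(α + Pi.single i 1 : Fin d → ℕ) j] F) f := by
  induction l with
  | nil => simp at hi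
  | cons j l ih =>
    rw [List.nodup_cons] at hl
    rw [List.foldr_cons, List.foldr_cons]
    by_cases hij : i = j
    · subst hij
      have h : l.foldr (fun j F => (pdDir (v j))^[(α + Pi.single i 1 : Fin d → ℕ) j] F) f =
          l.foldr (fun j F => (pdDir (v j))^[α j] F) f := by
        refine List.foldr_ext _ _ _ fun j hj F => ?_
        have : j ≠ i := fun h => hl.1 (h ▸ hj)
        simp [this]
      rw [h, ← Function.iterate_succ_apply' (pdDir (v i))]
      simp
    · have hil : i ∈ l := (List.mem_cons.1 hi).resolve_left hij
      rw [pdDir_comm_iterate (hf.foldr_pdDir v α l), ih hl.2 hil]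
      simp [Ne.symm hij]

theorem mderivWY_zero_left (β : Fin d → ℕ) (f : E × E → ℝ) :
    mderivWY (fun _ => 0) β f = (List.finRange d).foldr
      (fun i F => (pdDir ((0 : E), EuclideanSpace.single i (1 : ℝ)))^[β i] F) f := by
  have h (l : List (Fin d)) (F : E × E → ℝ) : l.foldr (fun _ F => F) F = F := by
    induction l with
    | nil => rfl
    | cons _ _ ih => exact ih
  exact h _ _

theorem ContDiff.mderivWY_zero_left {f : E × E → ℝ} (hf : ContDiff ℝ (⊤ : ℕ∞) f)
    (β : Fin d → ℕ) : ContDiff ℝ (⊤ : ℕ∞) (mderivWY (fun _ => 0) β f) := by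
  rw [_root_.mderivWY_zero_left]
  exact hf.foldr_pdDir _ _ _

theorem pdDir_mderivWY {f : E × E → ℝ} (hf : ContDiff ℝ (⊤ : ℕ∞) f) (β : Fin d → ℕ)
    (i : Fin d) :
    pdDir ((0 : E), EuclideanSpace.single i (1 : ℝ)) (mderivWY (fun _ => 0) β f) =
      mderivWY (fun _ => 0) (β + Pi.single i 1) f := by
  rw [mderivWY_zero_left, mderivWY_zero_left]
  exact pdDir_foldr hf (fun i => ((0 : E), EuclideanSpace.single i (1 : ℝ))) β i
    (List.nodup_finRange d) (List.mem_finRange i)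

theorem pd_rescale {f : E × E → ℝ} (hf : ContDiff ℝ (⊤ : ℕ∞) f) (w : E) (c s : ℝ)
    (i : Fin d) :
    pd i (fun y => c * f (w, s • y)) =
      fun y => c * s * pdDir ((0 : E), EuclideanSpace.single i (1 : ℝ)) f (w, s • y) := by
  funext y
  have h1 : HasFDerivAt (fun y : E => (w, s • y))
      ((0 : E →L[ℝ] E).prod (s • ContinuousLinearMap.id ℝ E)) y :=
    (hasFDerivAt_const w y).prodMk ((hasFDerivAt_id y).const_smul s)
  have h2 := (((hf.differentiable (by simp) (w, s • y)).hasFDerivAt.comp y h1).const_mul c).fderiv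
  change fderiv ℝ (fun y => c * f (w, s • y)) y _ = _
  have h3 : ((0 : E), s • EuclideanSpace.single i (1 : ℝ)) =
      s • ((0 : E), EuclideanSpace.single i (1 : ℝ)) := by simp
  simp only [Function.comp_def] at h2
  rw [h2]
  simp only [smul_apply, ContinuousLinearMap.comp_apply,
    ContinuousLinearMap.prod_apply, zero_apply, ContinuousLinearMap.id_apply,
    h3, map_smul, smul_eq_mul, pdDir, mul_assoc]

theorem pd_iterate_rescale {f : E × E → ℝ} (hf : ContDiff ℝ (⊤ : ℕ∞) f) (w : E) (c s : ℝ)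
    (i : Fin d) (n : ℕ) :
    (pd i)^[n] (fun y => c * f (w, s • y)) = fun y =>
      c * s ^ n * (pdDir ((0 : E), EuclideanSpace.single i (1 : ℝ)))^[n] f (w, s • y) := by
  induction n with
  | zero => simp
  | succ n ih =>
    rw [Function.iterate_succ_apply', ih, pd_rescale (hf.pdDir_iterate _ n),
      Function.iterate_succ_apply', pow_succ, ← mul_assoc]

theorem mderiv_rescale {f : E × E → ℝ} (hf : ContDiff ℝ (⊤ : ℕ∞) f) (w : E) (s : ℝ)
    (α : Fin d → ℕ) (y : E) :
    mderiv α (fun y => f (w, s • y)) y =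
      s ^ (∑ i, α i) * mderivWY (fun _ => 0) α f (w, s • y) := by
  have h (l : List (Fin d)) :
      l.foldr (fun i F => (pd i)^[α i] F) (fun y => f (w, s • y)) = fun y =>
        s ^ (l.map α).sum * l.foldr
          (fun i F => (pdDir ((0 : E), EuclideanSpace.single i (1 : ℝ)))^[α i] F) f
          (w, s • y) := by
    induction l with
    | nil => simp
    | cons i l ih =>
      rw [List.foldr_cons, ih, pd_iterate_rescale (hf.foldr_pdDir _ α l), List.map_cons,
        List.sum_cons, add_comm, pow_add]
      rfl
  rw [mderivWY_zero_left, mderiv, h, ← List.sum_ofFn, List.ofFn_eq_map]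

theorem ContinuousLinearMap.norm_le_sum_single (L : E →L[ℝ] ℝ) :
    ‖L‖ ≤ ∑ i, |L (EuclideanSpace.single i 1)| := by
  refine L.opNorm_le_bound (Finset.sum_nonneg fun _ _ => abs_nonneg _) fun v => ?_
  have hv : v = ∑ i, v i • (EuclideanSpace.single i (1 : ℝ) : E) := by
    simpa using ((EuclideanSpace.basisFun (Fin d) ℝ).sum_repr v).symm
  conv_lhs => rw [hv, map_sum]
  rw [Finset.sum_mul]
  refine (norm_sum_le _ _).trans (Finset.sum_le_sum fun i _ => ?_)
  rw [map_smul, norm_smul, mul_comm]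
  exact mul_le_mul_of_nonneg_left (PiLp.norm_apply_le v i) (abs_nonneg _)

theorem abs_le_mul_norm_of_pdDir_le {f : E × E → ℝ} (hf : ContDiff ℝ (⊤ : ℕ∞) f) {w : E}
    (h0 : f (w, 0) = 0) (u : E) {B : Fin d → ℝ}
    (hB : ∀ i, ∀ x : E, ‖x‖ ≤ ‖u‖ →
      |pdDir ((0 : E), EuclideanSpace.single i (1 : ℝ)) f (w, x)| ≤ B i) :
    |f (w, u)| ≤ (∑ i, B i) * ‖u‖ := by
  have hd (x : E) : HasFDerivAt (fun y : E => f (w, y))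
      ((fderiv ℝ f (w, x)).comp (ContinuousLinearMap.inr ℝ E E)) x :=
    (hf.differentiable (by simp) (w, x)).hasFDerivAt.comp x (hasFDerivAt_prodMk_right w x)
  have key := (convex_closedBall (0 : E) ‖u‖).norm_image_sub_le_of_norm_hasFDerivWithin_le
    (f := fun y => f (w, y)) (C := ∑ i, B i) (x := 0) (y := u)
    (fun x _ => (hd x).hasFDerivWithinAt)
    (fun x hx => (ContinuousLinearMap.norm_le_sum_single _).trans
      (Finset.sum_le_sum fun i _ => hB i x (by simpa using hx)))
    (by simp) (by simp)
  simpa [h0] using key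

theorem exists_bound_of_tendsto_cocompact {X : Type*} [TopologicalSpace X] {g : X → ℝ}
    (hg : Continuous g) (h : Tendsto g (cocompact X) (nhds 0)) :
    ∃ C, 0 ≤ C ∧ ∀ x, |g x| ≤ C := by
  obtain ⟨S, hS, hSg⟩ := mem_cocompact.1 (h (Metric.ball_mem_nhds 0 one_pos))
  obtain ⟨C, hC⟩ := hS.exists_bound_of_continuousOn hg.continuousOn
  refine ⟨max C 1, le_max_of_le_right zero_le_one, fun x => ?_⟩
  by_cases hx : x ∈ S
  · exact (hC x hx).trans (le_max_left _ _)
  · have : |g x| < 1 := by simpa using hSg hx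
    exact this.le.trans (le_max_right _ _)

/-- On a compact set of `w`, a `y`-derivative of order at least `N + 1 - k` is `O(|u|^k)`
near `u = 0`, with slower-than-exponential growth at infinity. -/
theorem exists_mderivWY_le_norm_pow_mul_exp {ρ : E × E → ℝ}
    (hsmooth : ContDiff ℝ (⊤ : ℕ∞) ρ)
    (hgrowth : ∀ γ : ℝ, 0 < γ → ∀ β : Fin d → ℕ,
      Tendsto (fun p => Real.exp (-γ * ‖p‖) * mderivWY (fun _ => 0) β ρ p)
        (cocompact (E × E)) (nhds 0))
    {N : ℕ} (hvanish : ∀ (w : E) (α : Fin d → ℕ), (∑ i, α i) ≤ N →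
      mderivWY (fun _ => 0) α ρ (w, 0) = 0)
    {γ : ℝ} (hγ : 0 < γ) {K : Set E} (hK : IsCompact K) (k : ℕ) (α : Fin d → ℕ)
    (hk : k ≤ N + 1 - ∑ i, α i) :
    ∃ C, 0 ≤ C ∧ ∀ w ∈ K, ∀ u : E,
      |mderivWY (fun _ => 0) α ρ (w, u)| ≤ C * (‖u‖ ^ k * Real.exp (γ * ‖u‖)) := by
  induction k generalizing α with
  | zero =>
    have hcont : Continuous fun p : E × E =>
        Real.exp (-γ * ‖p‖) * mderivWY (fun _ => 0) α ρ p :=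
      (by fun_prop : Continuous fun p : E × E => Real.exp (-γ * ‖p‖)).mul
        (hsmooth.mderivWY_zero_left α).continuous
    obtain ⟨C, hC0, hC⟩ := exists_bound_of_tendsto_cocompact hcont (hgrowth γ hγ α)
    obtain ⟨R, hR⟩ := hK.isBounded.exists_norm_le
    refine ⟨C * Real.exp (γ * R), by positivity, fun w hw u => ?_⟩
    have hR0 : 0 ≤ R := (norm_nonneg w).trans (hR w hw)
    have hp : ‖(w, u)‖ ≤ R + ‖u‖ :=
      max_le ((hR w hw).trans (by simp)) (by simpa using hR0)
    have h1 := hC (w, u)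
    rw [abs_mul, Real.abs_exp] at h1
    calc |mderivWY (fun _ => 0) α ρ (w, u)|
        = Real.exp (γ * ‖(w, u)‖) *
            (Real.exp (-γ * ‖(w, u)‖) * |mderivWY (fun _ => 0) α ρ (w, u)|) := by
          rw [← mul_assoc, ← Real.exp_add]
          simp
      _ ≤ Real.exp (γ * (R + ‖u‖)) * C := by gcongr
      _ = C * Real.exp (γ * R) * (‖u‖ ^ 0 * Real.exp (γ * ‖u‖)) := by
          rw [mul_add, Real.exp_add]
          ring
  | succ k ih =>
    have hsum (i : Fin d) : ∑ j, (α + Pi.single i 1 : Fin d → ℕ) j = ∑ j, α j + 1 := by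
      simp [Finset.sum_add_distrib]
    choose C hC0 hC using fun i => ih (α + Pi.single i 1) (by rw [hsum]; omega)
    refine ⟨∑ i, C i, Finset.sum_nonneg fun i _ => hC0 i, fun w hw u => ?_⟩
    have h := abs_le_mul_norm_of_pdDir_le (hsmooth.mderivWY_zero_left α)
      (hvanish w α (by omega)) u (B := fun i => C i * (‖u‖ ^ k * Real.exp (γ * ‖u‖)))
      fun i x hx => by
        rw [pdDir_mderivWY hsmooth]
        refine (hC i w hw x).trans ?_
        have := hC0 i
        gcongr
    rw [← Finset.sum_mul] at h
    exact h.trans_eq (by ring)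

end

/-- **Key lemma on Taylor remainders** (Lemma 3): if `ρ(w,y)` is smooth on `ℝ^{2d}` with
all derivatives of slower-than-exponential growth, and all `y`-partials of order `≤ N`
vanish at `y = 0`, then `σ^N ‖ρ_w(·/σ)‖_{γ,α} → 0` as `σ → ∞`, locally uniformly in
`w`. -/
theorem rho_lemma {d : ℕ}
    (ρ : EuclideanSpace ℝ (Fin d) × EuclideanSpace ℝ (Fin d) → ℝ)
    (hsmooth : ContDiff ℝ (⊤ : ℕ∞) ρ)
    (hgrowth : ∀ γ : ℝ, 0 < γ → ∀ α β : Fin d → ℕ,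
      Tendsto (fun p => Real.exp (-γ * ‖p‖) * mderivWY α β ρ p)
        (cocompact (EuclideanSpace ℝ (Fin d) × EuclideanSpace ℝ (Fin d))) (nhds 0))
    (N : ℕ)
    (hvanish : ∀ (w : EuclideanSpace ℝ (Fin d)) (α : Fin d → ℕ), (∑ i, α i) ≤ N →
      mderivWY (fun _ => 0) α ρ (w, 0) = 0) :
    ∀ γ : ℝ, 0 < γ → ∀ α : Fin d → ℕ,
      ∀ K : Set (EuclideanSpace ℝ (Fin d)), IsCompact K →
      ∀ ε > (0 : ℝ), ∀ᶠ σ : ℝ in atTop, ∀ w ∈ K, ∀ y : EuclideanSpace ℝ (Fin d),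
        σ ^ N * |Real.exp (-γ * ‖y‖) *
          mderiv α (fun y' => ρ (w, σ⁻¹ • y')) y| < ε := by
  intro γ hγ α K hK ε hε
  set m := ∑ i, α i with hm
  set k := N + 1 - m with hk
  obtain ⟨C, hC0, hC⟩ := exists_mderivWY_le_norm_pow_mul_exp hsmooth
    (fun γ hγ β => hgrowth γ hγ _ β) hvanish (half_pos hγ) hK k α le_rfl
  set M := C * ((2 / γ) ^ k * k.factorial) with hM
  have hM0 : 0 ≤ M := by positivity
  filter_upwards [eventually_ge_atTop 1, eventually_gt_atTop (M / ε)] with σ hσ1 hσM w hw y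
  have hσ0 : 0 < σ := one_pos.trans_le hσ1
  have hnorm : ‖σ⁻¹ • y‖ = σ⁻¹ * ‖y‖ := by
    rw [norm_smul, Real.norm_of_nonneg (by positivity)]
  have hle : σ⁻¹ * ‖y‖ ≤ ‖y‖ :=
    mul_le_of_le_one_left (norm_nonneg y) (inv_le_one_of_one_le₀ hσ1)
  have hpow : σ ^ N * (σ⁻¹ ^ m * σ⁻¹ ^ k) ≤ σ⁻¹ := by
    have h1 : σ⁻¹ ^ (m + k) ≤ σ⁻¹ ^ (N + 1) :=
      pow_le_pow_of_le_one (by positivity) (inv_le_one_of_one_le₀ hσ1) (by omega)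
    calc σ ^ N * (σ⁻¹ ^ m * σ⁻¹ ^ k) ≤ σ ^ N * σ⁻¹ ^ (N + 1) := by
          rw [← pow_add]
          gcongr
      _ = σ⁻¹ := by
          rw [pow_succ, ← mul_assoc, ← mul_pow, mul_inv_cancel₀ hσ0.ne', one_pow, one_mul]
  have hexp : ‖y‖ ^ k ≤ (2 / γ) ^ k * k.factorial * Real.exp (γ / 2 * ‖y‖) := by
    have h1 := Real.pow_div_factorial_le_exp (γ / 2 * ‖y‖) (by positivity) k
    rw [div_le_iff₀ (by positivity)] at h1
    calc ‖y‖ ^ k = (2 / γ) ^ k * (γ / 2 * ‖y‖) ^ k := by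
          rw [← mul_pow]
          field_simp
      _ ≤ (2 / γ) ^ k * (Real.exp (γ / 2 * ‖y‖) * k.factorial) := by gcongr
      _ = _ := by ring
  have hcancel : Real.exp (-γ * ‖y‖) *
      (Real.exp (γ / 2 * ‖y‖) * Real.exp (γ / 2 * ‖y‖)) = 1 := by
    rw [← Real.exp_add, ← Real.exp_add, ← Real.exp_zero]
    ring_nf
  rw [mderiv_rescale hsmooth, abs_mul, Real.abs_exp, abs_mul, ← hm,
    abs_of_nonneg (by positivity : 0 ≤ σ⁻¹ ^ m)]
  calc σ ^ N * (Real.exp (-γ * ‖y‖) *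
        (σ⁻¹ ^ m * |mderivWY (fun _ => 0) α ρ (w, σ⁻¹ • y)|))
      ≤ σ ^ N * (Real.exp (-γ * ‖y‖) *
        (σ⁻¹ ^ m * (C * ((σ⁻¹ * ‖y‖) ^ k * Real.exp (γ / 2 * ‖y‖))))) := by
        gcongr
        refine (hC w hw _).trans ?_
        rw [hnorm]
        gcongr
    _ = (σ ^ N * (σ⁻¹ ^ m * σ⁻¹ ^ k)) * (C * (Real.exp (-γ * ‖y‖) *
        (‖y‖ ^ k * Real.exp (γ / 2 * ‖y‖)))) := by
        rw [mul_pow]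
        ring
    _ ≤ σ⁻¹ * (C * (Real.exp (-γ * ‖y‖) *
        ((2 / γ) ^ k * k.factorial * Real.exp (γ / 2 * ‖y‖) * Real.exp (γ / 2 * ‖y‖)))) := by
        gcongr
    _ = σ⁻¹ * (M * (Real.exp (-γ * ‖y‖) *
        (Real.exp (γ / 2 * ‖y‖) * Real.exp (γ / 2 * ‖y‖)))) := by
        rw [hM]
        ring
    _ = M / σ := by rw [hcancel, mul_one, div_eq_inv_mul]
    _ < ε := by
        rw [div_lt_iff₀ hσ0]
        rwa [div_lt_iff₀ hε, mul_comm] at hσM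
end
end
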